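/- Let m ≥ 1, n ≥ 1 and let A_0,…,A_{2m−1}, B_0,…,B_{2n−1} be finite-dimensional complex Hilbert spaces; set H := A_0⊗⋯⊗A_{2m−1}⊗B_0⊗⋯⊗B_{2n−1}. Let σ_↔ ∈ Σ_{m,n} be the block-exchange shuffle defined by σ_↔(i) = n+i for 0 ≤ i < m and σ_↔(m+j) = j for 0 ≤ j < n. Then K_{id} ∩ K_{σ_↔} equals the set of positive semidefinite operators on H lying in the affine span (over ℝ, inside the Hermitian operators on H) of { M⊗N : M ∈ Comb_m(A_0,…,A_{2m−1}), N ∈ Comb_n(B_0,…,B_{2n−1}) }, where id is the identity permutation. -/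

import Mathlib

open Matrix Kronecker ComplexOrder

noncomputable section

private theorem cast_pi {G : ℕ → Type} {q : ℕ} (f : ∀ j : Fin q, G j) {a b : ℕ}
    (h : a = b) (ha : a < q) (hb : b < q) :
    cast (congrArg G h) (f ⟨a, ha⟩) = f ⟨b, hb⟩ := by subst h; rfl

/-- Reinterpreting a tensor product along an equality of the number of factors. -/
def piFinCast (H : ℕ → Type) {q q' : ℕ} (h : q = q') :
    (∀ j : Fin q, H j) ≃ (∀ j : Fin q', H j) where
  toFun f j := f ⟨j, h ▸ j.isLt⟩
  invFun f j := f ⟨j, h ▸ j.isLt⟩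
  left_inv f := rfl
  right_inv f := rfl

/-- The canonical identification of `H_0 ⊗ H_1 ⊗ ⋯ ⊗ H_{k+1}` with
`H_0 ⊗ (H_1 ⊗ ⋯ ⊗ H_k) ⊗ H_{k+1}`. -/
def splitEnds (H : ℕ → Type) (k : ℕ) :
    (∀ j : Fin (k + 2), H j) ≃ (H 0 × (∀ j : Fin k, H (j + 1)) × H (k + 1)) where
  toFun f := (f ⟨0, by omega⟩, fun j => f ⟨(j : ℕ) + 1, by omega⟩, f ⟨k + 1, by omega⟩)
  invFun x j :=
    if h0 : (j : ℕ) = 0 then cast (congrArg H h0.symm) x.1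
    else if hk : (j : ℕ) = k + 1 then cast (congrArg H hk.symm) x.2.2
    else cast (congrArg H (by omega : (j : ℕ) - 1 + 1 = (j : ℕ)))
      (x.2.1 ⟨(j : ℕ) - 1, by omega⟩)
  left_inv f := by
    funext j
    dsimp only
    split_ifs with h0 hk
    · exact cast_pi f h0.symm (by omega) (by omega)
    · exact cast_pi f hk.symm (by omega) (by omega)
    · exact cast_pi f (by omega) (by omega) (by omega)
  right_inv x := by
    obtain ⟨a, g, b⟩ := x
    refine Prod.ext ?_ (Prod.ext ?_ ?_)
    · rfl
    · funext j
      dsimp only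
      rw [dif_neg (by omega), dif_neg (by have := j.isLt; omega)]
      exact cast_eq _ (g j)
    · dsimp only
      rw [dif_neg (by omega), dif_pos rfl]
      exact cast_eq _ b


/-- Partial trace over the middle tensor factor. -/
def ptrMid {α β γ : Type*} [Fintype β] (M : Matrix (α × β × γ) (α × β × γ) ℂ) :
    Matrix (α × γ) (α × γ) ℂ :=
  fun p q => ∑ b, M (p.1, b, p.2) (q.1, b, q.2)

/-- Partial trace over the last of `k+1` tensor factors. -/
def trLast {H : ℕ → Type} [∀ j, Fintype (H j)] (k : ℕ)
    (R : Matrix (∀ j : Fin (k + 1), H j) (∀ j : Fin (k + 1), H j) ℂ) :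
    Matrix (∀ j : Fin k, H j) (∀ j : Fin k, H j) ℂ :=
  fun u v => ∑ b : H k, R (Fin.snoc u b) (Fin.snoc v b)

/-- The set of deterministic 1-combs on a pair of factors `α ⊗ β`: positive semidefinite
operators whose partial trace over `β` is the identity on `α`. -/
def comb1Set (α β : Type*) [Fintype α] [DecidableEq α] [Fintype β] :
    Set (Matrix (α × β) (α × β) ℂ) :=
  {M | M.PosSemidef ∧ (fun a a' => ∑ b, M (a, b) (a', b)) = (1 : Matrix α α ℂ)}

/-- The set `Comb_n(H_0,…,H_{2n−1})` of deterministic `n`-combs, defined recursively: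
a `1`-comb is a PSD operator `R` on `H_0⊗H_1` with `Tr_{H_1}[R] = I_{H_0}`; an `n`-comb
(`n ≥ 2`) is a PSD operator `R` on `H_0⊗⋯⊗H_{2n−1}` such that for every `(n−1)`-comb `S` on
`H_1⊗⋯⊗H_{2n−2}` the operator `Tr_{H_1⊗⋯⊗H_{2n−2}}[(I_{H_0}⊗S⊗I_{H_{2n−1}})·R]` is a
`1`-comb on `H_0⊗H_{2n−1}`.  (The value at `n = 0` is irrelevant and set to `∅`.) -/
def Comb : (n : ℕ) → (H : ℕ → Type) → [∀ j, Fintype (H j)] → [∀ j, DecidableEq (H j)] →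
    Set (Matrix (∀ j : Fin (2 * n), H j) (∀ j : Fin (2 * n), H j) ℂ)
  | 0, _, _, _ => ∅
  | 1, H, _, _ => {R | R.PosSemidef ∧ trLast 1 R = (1 : Matrix (∀ j : Fin 1, H j) (∀ j : Fin 1, H j) ℂ)}
  | (n + 2), H, _, _ =>
    {R | R.PosSemidef ∧ ∀ S ∈ Comb (n + 1) (fun m => H (m + 1)),
      ptrMid (((1 : Matrix (H 0) (H 0) ℂ) ⊗ₖ
          (S ⊗ₖ (1 : Matrix (H (2 * (n + 1) + 1)) (H (2 * (n + 1) + 1)) ℂ))) *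
        (Matrix.reindex (splitEnds H (2 * (n + 1))) (splitEnds H (2 * (n + 1))) R)) ∈
      comb1Set (H 0) (H (2 * (n + 1) + 1))}


/-- The partial trace over the first tensor factor. -/
def ptrLeft {α β : Type*} [Fintype α] (M : Matrix (α × β) (α × β) ℂ) : Matrix β β ℂ :=
  fun b b' => ∑ a, M (a, b) (a, b')

/-- The canonical identification of `H_0⊗⋯⊗H_{a+b−1}` with
`(H_0⊗⋯⊗H_{a−1}) ⊗ (H_a⊗⋯⊗H_{a+b−1})`. -/
def splitPi (a b : ℕ) (H : ℕ → Type) :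
    (∀ j : Fin (a + b), H j) ≃ ((∀ j : Fin a, H j) × (∀ j : Fin b, H (a + j))) where
  toFun f := (fun j => f (Fin.castAdd b j), fun j => f (Fin.natAdd a j))
  invFun x j :=
    if h : (j : ℕ) < a then x.1 ⟨(j : ℕ), h⟩
    else cast (congrArg H (by omega : a + ((j : ℕ) - a) = (j : ℕ)))
      (x.2 ⟨(j : ℕ) - a, by omega⟩)
  left_inv f := by
    funext j
    dsimp only
    split_ifs with h
    · rfl
    · exact cast_pi f (show a + ((j : ℕ) - a) = (j : ℕ) by omega) (by omega) j.isLt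
  right_inv x := by
    obtain ⟨u, v⟩ := x
    refine Prod.ext ?_ ?_
    · funext j
      dsimp only
      rw [dif_pos (show ((Fin.castAdd b j : Fin (a + b)) : ℕ) < a from j.isLt)]
      rfl
    · funext j
      dsimp only
      rw [dif_neg (show ¬(((Fin.natAdd a j : Fin (a + b)) : ℕ) < a) by
        simp only [Fin.coe_natAdd]; omega)]
      exact cast_pi (G := fun m => H (a + m)) v
        (show ((Fin.natAdd a j : Fin (a + b)) : ℕ) - a = (j : ℕ) by
          simp only [Fin.coe_natAdd]; omega)
        (by simp only [Fin.coe_natAdd]; omega) j.isLt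

/-- Extension of a permutation of `Fin q` to `ℕ` (fixing everything `≥ q`). -/
def extendPerm {q : ℕ} (σ : Equiv.Perm (Fin q)) : ℕ → ℕ :=
  fun i => if h : i < q then (σ ⟨i, h⟩ : ℕ) else i

/-- The canonical tensor-factor permutation: reinterpreting an element of
`H_0⊗⋯⊗H_{q−1}` as an element of `H_{σ(0)}⊗⋯⊗H_{σ(q−1)}` (the space whose `j`-th factor is
the original factor `σ(j)`). -/
def permEquiv (H : ℕ → Type) {q : ℕ} (σ : Equiv.Perm (Fin q)) :
    (∀ j : Fin q, H j) ≃ (∀ j : Fin q, H (extendPerm σ j)) :=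
  (Equiv.piCongrLeft' (fun i : Fin q => H i) σ.symm).trans
    (Equiv.piCongrRight fun j =>
      Equiv.cast (congrArg H (by simp [extendPerm] : ((σ j : Fin q) : ℕ) = extendPerm σ j)))

/-- The pairing `(k,r) ↦ 2k+r` of a tooth index and a position within the tooth. -/
def toothPairEquiv (p : ℕ) : Fin p × Fin 2 ≃ Fin (2 * p) where
  toFun x := ⟨2 * (x.1 : ℕ) + (x.2 : ℕ), by have := x.1.isLt; have := x.2.isLt; omega⟩
  invFun j := (⟨(j : ℕ) / 2, by have := j.isLt; omega⟩, ⟨(j : ℕ) % 2, by omega⟩)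
  left_inv x := by
    obtain ⟨a, r⟩ := x
    have hr := r.isLt
    refine Prod.ext (Fin.ext ?_) (Fin.ext ?_) <;> simp only [] <;> omega
  right_inv j := by
    apply Fin.ext
    simp only []
    omega

/-- The factor-level permutation induced by a permutation `σ` of teeth, placing tooth `T_i`
(the pair of factors `(2i, 2i+1)`) in tooth-position `σ(i)`:  the factor at new position
`2k+r` (`r ∈ {0,1}`) is the original factor `2·σ⁻¹(k)+r`. -/
def toothReorder {p : ℕ} (σ : Equiv.Perm (Fin p)) : Equiv.Perm (Fin (2 * p)) :=
  (toothPairEquiv p).permCongr (Equiv.prodCongr σ.symm (Equiv.refl (Fin 2)))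


/-- `K_σ` for a shuffle `σ` of the `m+n` teeth: the set of PSD operators `R` on
`A_0⊗⋯⊗A_{2m−1}⊗B_0⊗⋯⊗B_{2n−1}` (with `A_j := H_j`, `B_j := H_{2m+j}`) whose image under
the canonical tensor-factor permutation placing tooth `T_i` in tooth-position `σ(i)` is a
deterministic `(m+n)`-comb of the correspondingly reordered spaces. -/
def Kset (m n : ℕ) (H : ℕ → Type) [∀ j, Fintype (H j)] [∀ j, DecidableEq (H j)]
    (σ : Equiv.Perm (Fin (m + n))) :
    Set (Matrix (∀ j : Fin (2 * m + 2 * n), H j) (∀ j : Fin (2 * m + 2 * n), H j) ℂ) :=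
  {R | R.PosSemidef ∧
    Matrix.reindex
        ((piFinCast H (by omega : 2 * m + 2 * n = 2 * (m + n))).trans
          (permEquiv H (toothReorder σ)))
        ((piFinCast H (by omega : 2 * m + 2 * n = 2 * (m + n))).trans
          (permEquiv H (toothReorder σ))) R ∈
      Comb (m + n) (fun i => H (extendPerm (toothReorder σ) i))}

/-- The block-exchange shuffle `σ↔` of `m+n` teeth: `σ(i) = n+i` for `i < m` and
`σ(m+j) = j` for `0 ≤ j < n`. -/
def sigmaSwap (m n : ℕ) : Equiv.Perm (Fin (m + n)) where
  toFun i := ⟨if (i : ℕ) < m then n + (i : ℕ) else (i : ℕ) - m,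
    by have := i.isLt; split_ifs <;> omega⟩
  invFun i := ⟨if (i : ℕ) < n then m + (i : ℕ) else (i : ℕ) - n,
    by have := i.isLt; split_ifs <;> omega⟩
  left_inv i := by
    have := i.isLt
    apply Fin.ext
    simp only [Fin.val_mk]
    split_ifs <;> first | omega | exact (‹False›).elim
  right_inv i := by
    have := i.isLt
    apply Fin.ext
    simp only [Fin.val_mk]
    split_ifs <;> first | omega | exact (‹False›).elim



set_option linter.unusedSectionVars false
set_option linter.unusedSimpArgs false

section General

variable {ι : Type} [Fintype ι] [DecidableEq ι] {H : ι → Type}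
  [∀ i, Fintype (H i)] [∀ i, DecidableEq (H i)]

/-- Product operator. -/
def prodOp (X : ∀ i, Matrix (H i) (H i) ℂ) : Matrix (∀ i, H i) (∀ i, H i) ℂ :=
  fun u v => ∏ i, X i (u i) (v i)

/-- Pairing with a product operator. -/
def ph (R : Matrix (∀ i, H i) (∀ i, H i) ℂ) (X : ∀ i, Matrix (H i) (H i) ℂ) : ℂ :=
  (R * prodOp X).trace

theorem trace_prodOp (X : ∀ i, Matrix (H i) (H i) ℂ) :
    (prodOp X).trace = ∏ i, (X i).trace := by
  simp only [Matrix.trace, Matrix.diag, prodOp]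
  rw [Finset.prod_univ_sum, Fintype.piFinset_univ]

theorem prodOp_mul (X Y : ∀ i, Matrix (H i) (H i) ℂ) :
    prodOp X * prodOp Y = prodOp (fun i => X i * Y i) := by
  ext u v
  simp only [Matrix.mul_apply, prodOp]
  rw [Finset.prod_univ_sum, Fintype.piFinset_univ]
  simp [Finset.prod_mul_distrib]

theorem prodOp_one : prodOp (fun i => (1 : Matrix (H i) (H i) ℂ)) = 1 := by
  ext u v
  simp only [prodOp, Matrix.one_apply, Finset.prod_ite_zero, funext_iff]
  simp

theorem prodOp_transpose (X : ∀ i, Matrix (H i) (H i) ℂ) :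
    (prodOp X)ᵀ = prodOp (fun i => (X i)ᵀ) := rfl

theorem prodOp_conjTranspose (X : ∀ i, Matrix (H i) (H i) ℂ) :
    (prodOp X)ᴴ = prodOp (fun i => (X i)ᴴ) := by
  ext u v
  simp [prodOp, Matrix.conjTranspose_apply, star_prod]

theorem ph_prodOp (P X : ∀ i, Matrix (H i) (H i) ℂ) :
    ph (prodOp P) X = ∏ i, (P i * X i).trace := by
  rw [ph, prodOp_mul, trace_prodOp]

theorem ph_add (R S : Matrix (∀ i, H i) (∀ i, H i) ℂ) (X) : ph (R + S) X = ph R X + ph S X := by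
  simp [ph, add_mul]
theorem ph_sub (R S : Matrix (∀ i, H i) (∀ i, H i) ℂ) (X) : ph (R - S) X = ph R X - ph S X := by
  simp [ph, sub_mul]
theorem ph_smul (c : ℂ) (R : Matrix (∀ i, H i) (∀ i, H i) ℂ) (X) : ph (c • R) X = c * ph R X := by
  simp [ph]
theorem ph_rsmul (c : ℝ) (R : Matrix (∀ i, H i) (∀ i, H i) ℂ) (X) :
    ph (c • R) X = c * ph R X := by
  simp [ph]
theorem ph_one (R : Matrix (∀ i, H i) (∀ i, H i) ℂ) : ph R (fun _ => 1) = R.trace := by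
  simp [ph, prodOp_one]

theorem ph_conjTranspose (R : Matrix (∀ i, H i) (∀ i, H i) ℂ) (X) :
    ph Rᴴ X = star (ph R (fun i => (X i)ᴴ)) := by
  rw [ph, ph, ← Matrix.trace_conjTranspose, Matrix.conjTranspose_mul, ← prodOp_conjTranspose,
    Matrix.conjTranspose_conjTranspose, Matrix.trace_mul_comm]

/-- frame -/
def fb (α : Type) [Fintype α] [DecidableEq α] : Option (α × α) → Matrix α α ℂ
  | none => 1
  | some p => fun i j => (if p.1 = i ∧ p.2 = j then 1 else 0) -
      (if p.1 = p.2 ∧ i = j then (Fintype.card α : ℂ)⁻¹ else 0)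

def fw (α : Type) [Fintype α] : Option (α × α) → ℂ
  | none => (Fintype.card α : ℂ)⁻¹
  | some _ => 1

theorem fb_trace (α : Type) [Fintype α] [DecidableEq α] (a : Option (α × α)) (ha : a ≠ none) :
    (fb α a).trace = 0 := by
  obtain ⟨⟨p, q⟩, rfl⟩ := Option.ne_none_iff_exists'.mp ha
  simp only [Matrix.trace, Matrix.diag, fb, Finset.sum_sub_distrib, and_true]
  have : Nonempty α := ⟨p⟩
  have hc : (Fintype.card α : ℂ) ≠ 0 := by exact_mod_cast Fintype.card_ne_zero
  by_cases h : p = q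
  · subst h
    simp [hc]
  · have : ∀ x, ¬ (p = x ∧ q = x) := fun x hx => h (hx.1.trans hx.2.symm)
    simp [h, this]

theorem frame (α : Type) [Fintype α] [DecidableEq α] (i j k l : α) :
    ∑ a, fw α a * (fb α a i j * fb α a l k) = if i = l ∧ j = k then 1 else 0 := by
  have : Nonempty α := ⟨i⟩
  have hc : (Fintype.card α : ℂ) ≠ 0 := by exact_mod_cast Fintype.card_ne_zero
  rw [Fintype.sum_option, Fintype.sum_prod_type]
  simp only [fw, fb, one_mul, Matrix.one_apply, sub_mul, mul_sub, Finset.sum_sub_distrib]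
  have e1 : ∀ (P : Prop) [Decidable P] (Q : Prop) [Decidable Q] (a b : ℂ),
    (if P then a else 0) * (if Q then b else 0) = if P ∧ Q then a * b else 0 := by
    intros; split_ifs <;> simp_all
  simp only [e1]
  have s1 : ∑ x, ∑ y, (if (x = i ∧ y = j) ∧ x = l ∧ y = k then (1:ℂ) * 1 else 0)
      = if i = l ∧ j = k then 1 else 0 := by
    rw [Finset.sum_eq_single i, Finset.sum_eq_single j] <;> simp +contextual
  have s2 : ∑ x, ∑ y, (if (x = i ∧ y = j) ∧ x = y ∧ l = k then (1:ℂ) * (Fintype.card α : ℂ)⁻¹ else 0)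
      = if i = j ∧ l = k then (Fintype.card α : ℂ)⁻¹ else 0 := by
    rw [Finset.sum_eq_single i, Finset.sum_eq_single j] <;> simp +contextual
  have s3 : ∑ x, ∑ y, (if (x = y ∧ i = j) ∧ x = l ∧ y = k then (Fintype.card α : ℂ)⁻¹ * 1 else 0)
      = if i = j ∧ l = k then (Fintype.card α : ℂ)⁻¹ else 0 := by
    rw [Finset.sum_eq_single l, Finset.sum_eq_single k] <;> simp +contextual [and_comm]
  have s4 : ∑ x : α, ∑ y, (if (x = y ∧ i = j) ∧ x = y ∧ l = k then
      (Fintype.card α : ℂ)⁻¹ * (Fintype.card α : ℂ)⁻¹ else 0)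
      = if i = j ∧ l = k then (Fintype.card α : ℂ)⁻¹ else 0 := by
    by_cases h : i = j ∧ l = k
    · simp [h, hc]
    · rw [if_neg h]
      refine Finset.sum_eq_zero fun x _ => Finset.sum_eq_zero fun y _ => if_neg ?_
      tauto
  simp only [s1, s2, s3, s4]
  by_cases h : i = j ∧ l = k <;> simp [h]

theorem expand (R : Matrix (∀ i, H i) (∀ i, H i) ℂ) :
    R = ∑ γ : (∀ i, Option (H i × H i)),
      ((∏ i, fw (H i) (γ i)) * ph R (fun i => fb (H i) (γ i))) •
        (prodOp (fun i => fb (H i) (γ i)))ᵀ := by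
  ext x y
  have key : ∀ u v : (∀ i, H i), ∑ γ : (∀ i, Option (H i × H i)),
      (∏ i, fw (H i) (γ i)) * ((∏ i, fb (H i) (γ i) (v i) (u i)) *
        (∏ i, fb (H i) (γ i) (y i) (x i))) = if v = y ∧ u = x then 1 else 0 := by
    intro u v
    simp only [← Finset.prod_mul_distrib]
    have := Finset.prod_univ_sum (fun i => (Finset.univ : Finset (Option (H i × H i))))
      (fun i a => fw (H i) a * (fb (H i) a (v i) (u i) * fb (H i) a (y i) (x i)))
    rw [Fintype.piFinset_univ] at this
    rw [← this]
    simp only [frame, Finset.prod_ite_zero, funext_iff]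
    simp [forall_and]
  simp only [Matrix.sum_apply, Matrix.smul_apply, Matrix.transpose_apply, smul_eq_mul, ph,
    Matrix.trace, Matrix.diag, Matrix.mul_apply, prodOp]
  calc R x y = ∑ u, ∑ v, R u v * (if v = y ∧ u = x then 1 else 0) := by
        rw [Finset.sum_eq_single x, Finset.sum_eq_single y] <;> simp +contextual
    _ = ∑ u, ∑ v, ∑ γ : (∀ i, Option (H i × H i)), R u v * ((∏ i, fw (H i) (γ i)) *
          ((∏ i, fb (H i) (γ i) (v i) (u i)) * (∏ i, fb (H i) (γ i) (y i) (x i)))) := by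
        simp only [← key, Finset.mul_sum]
    _ = _ := by
        rw [Finset.sum_congr rfl fun u _ => Finset.sum_comm, Finset.sum_comm]
        refine Finset.sum_congr rfl fun γ _ => ?_
        rw [Finset.mul_sum, Finset.sum_mul]
        refine Finset.sum_congr rfl fun u _ => ?_
        rw [Finset.mul_sum, Finset.sum_mul]
        refine Finset.sum_congr rfl fun v _ => ?_
        ring

/-- homogeneous comb conditions -/
def Chain (ord : ι → ℕ) (R : Matrix (∀ i, H i) (∀ i, H i) ℂ) : Prop :=
  ∀ (X : ∀ i, Matrix (H i) (H i) ℂ) (j : ι), Even (ord j) → (X j).trace = 0 →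
    (∀ i, ord j < ord i → X i = 1) → ph R X = 0

theorem Chain.add {ord : ι → ℕ} {R S : Matrix (∀ i, H i) (∀ i, H i) ℂ}
    (hR : Chain ord R) (hS : Chain ord S) : Chain ord (R + S) := fun X j a b c => by
  rw [ph_add, hR X j a b c, hS X j a b c, add_zero]
theorem Chain.sub {ord : ι → ℕ} {R S : Matrix (∀ i, H i) (∀ i, H i) ℂ}
    (hR : Chain ord R) (hS : Chain ord S) : Chain ord (R - S) := fun X j a b c => by
  rw [ph_sub, hR X j a b c, hS X j a b c, sub_zero]
theorem Chain.smul {ord : ι → ℕ} {R : Matrix (∀ i, H i) (∀ i, H i) ℂ}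
    (hR : Chain ord R) (k : ℂ) : Chain ord (k • R) := fun X j a b c => by
  rw [ph_smul, hR X j a b c, mul_zero]
theorem Chain.rsmul {ord : ι → ℕ} {R : Matrix (∀ i, H i) (∀ i, H i) ℂ}
    (hR : Chain ord R) (k : ℝ) : Chain ord (k • R) := fun X j a b c => by
  rw [ph_rsmul, hR X j a b c, mul_zero]
theorem Chain.conjTranspose {ord : ι → ℕ} {R : Matrix (∀ i, H i) (∀ i, H i) ℂ}
    (hR : Chain ord R) : Chain ord Rᴴ := fun X j a b c => by
  rw [ph_conjTranspose, hR _ j a (by rw [Matrix.trace_conjTranspose, b, star_zero])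
    (fun i hi => by rw [c i hi, Matrix.conjTranspose_one]), star_zero]
theorem Chain.one {ord : ι → ℕ} : Chain ord (1 : Matrix (∀ i, H i) (∀ i, H i) ℂ) :=
  fun X j _ b _ => by
    rw [ph, one_mul, trace_prodOp]
    exact Finset.prod_eq_zero (Finset.mem_univ j) b

def good (ord : ι → ℕ) (γ : ∀ i, Option (H i × H i)) : Prop :=
  ∀ j, Even (ord j) → (∀ i, ord j < ord i → γ i = none) → γ j = none

theorem good_chain {ord : ι → ℕ} {γ : ∀ i, Option (H i × H i)} (h : good ord γ) :
    Chain ord (prodOp (fun i => fb (H i) (γ i)))ᵀ := fun X j a b c => by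
  rw [prodOp_transpose, ph_prodOp]
  by_cases hi : ∃ i, ord j < ord i ∧ γ i ≠ none
  · obtain ⟨i, hi, hg⟩ := hi
    refine Finset.prod_eq_zero (Finset.mem_univ i) ?_
    rw [c i hi, mul_one, Matrix.trace_transpose, fb_trace _ _ hg]
  · push Not at hi
    refine Finset.prod_eq_zero (Finset.mem_univ j) ?_
    rw [h j a hi]
    simp [fb, b]

theorem Chain.good {ord : ι → ℕ} {R : Matrix (∀ i, H i) (∀ i, H i) ℂ}
    (hR : Chain ord R) {γ : ∀ i, Option (H i × H i)}
    (h : ph R (fun i => fb (H i) (γ i)) ≠ 0) : good ord γ := fun j a b => by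
  by_contra hg
  refine h (hR _ j a (fb_trace _ _ hg) fun i hi => ?_)
  rw [b i hi]; rfl

/-- normalisation -/
def nrm (H : ι → Type) [∀ i, Fintype (H i)] (ord : ι → ℕ) : ℝ :=
  ∏ i, if Even (ord i) then (Fintype.card (H i) : ℝ) else 1

def CombG (H : ι → Type) [∀ i, Fintype (H i)] [∀ i, DecidableEq (H i)] (ord : ι → ℕ) :
    Set (Matrix (∀ i, H i) (∀ i, H i) ℂ) :=
  {R | R.PosSemidef ∧ Chain ord R ∧ R.trace = nrm H ord}

theorem nrm_pos [∀ i, Nonempty (H i)] (ord : ι → ℕ) : 0 < nrm H ord := by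
  refine Finset.prod_pos fun i _ => ?_
  split_ifs
  · exact_mod_cast Fintype.card_pos
  · exact one_pos

theorem exists_shift {α : Type} [Fintype α] [DecidableEq α] (Q : Matrix α α ℂ)
    (hQ : Q.IsHermitian) : ∃ r : ℝ, 0 < r ∧ (r • (1 : Matrix α α ℂ) + Q).PosSemidef := by
  obtain ⟨r, hr, h⟩ : ∃ r : ℝ, 0 < r ∧ ∀ i, 0 ≤ r + hQ.eigenvalues i := by
    refine ⟨1 + ∑ i, |hQ.eigenvalues i|, by positivity, fun i => ?_⟩
    have := Finset.single_le_sum (f := fun i => |hQ.eigenvalues i|) (fun i _ => abs_nonneg _)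
      (Finset.mem_univ i)
    have h2 := neg_abs_le (hQ.eigenvalues i)
    linarith
  refine ⟨r, hr, ?_⟩
  set U := (hQ.eigenvectorUnitary : Matrix α α ℂ) with hU
  have hUU : U * Uᴴ = 1 := by
    rw [← Matrix.star_eq_conjTranspose]
    exact Unitary.coe_mul_star_self hQ.eigenvectorUnitary
  have hs := hQ.spectral_theorem
  rw [Unitary.conjStarAlgAut_apply] at hs
  have : r • (1 : Matrix α α ℂ) + Q =
      U * (Matrix.diagonal (fun i => ((r + hQ.eigenvalues i : ℝ) : ℂ))) * Uᴴ := by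
    have hd : Matrix.diagonal (fun i => ((r + hQ.eigenvalues i : ℝ) : ℂ)) =
      (r : ℂ) • (1 : Matrix α α ℂ) + Matrix.diagonal (RCLike.ofReal ∘ hQ.eigenvalues) := by
      ext i j
      by_cases hij : i = j
      · subst hij; simp
      · simp [hij]
    rw [hd, mul_add, add_mul, mul_smul_comm, mul_one, smul_mul_assoc, hUU]
    conv_lhs => rw [hs]
    rfl
  rw [this]
  refine Matrix.PosSemidef.mul_mul_conjTranspose_same (Matrix.PosSemidef.diagonal ?_) U
  intro i
  simp only [Pi.zero_apply]
  exact_mod_cast h i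

theorem CombG_scalar [∀ i, Nonempty (H i)] (ord : ι → ℕ) :
    ((nrm H ord / Fintype.card (∀ i, H i) : ℝ) • (1 : Matrix (∀ i, H i) (∀ i, H i) ℂ)) ∈
      CombG H ord := by
  have hc : 0 < (Fintype.card (∀ i, H i) : ℝ) := by exact_mod_cast Fintype.card_pos
  have hn := nrm_pos (H := H) ord
  refine ⟨Matrix.PosSemidef.one.smul (by positivity), Chain.one.rsmul _, ?_⟩
  rw [Matrix.trace_smul, Matrix.trace_one, Complex.real_smul]
  have : (Fintype.card (∀ i, H i) : ℂ) ≠ 0 := by exact_mod_cast hc.ne'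
  rw [Complex.ofReal_div]
  simp only [Complex.ofReal_natCast]
  field_simp

theorem chain_herm_span [∀ i, Nonempty (H i)] {ord : ι → ℕ}
    {Q : Matrix (∀ i, H i) (∀ i, H i) ℂ} (hQ : Chain ord Q) (hH : Q.IsHermitian) :
    Q ∈ Submodule.span ℂ (CombG H ord) := by
  have hc : 0 < (Fintype.card (∀ i, H i) : ℝ) := by exact_mod_cast Fintype.card_pos
  have hn := nrm_pos (H := H) ord
  set d : ℝ := (Fintype.card (∀ i, H i) : ℝ) with hd
  have h1 : (1 : Matrix (∀ i, H i) (∀ i, H i) ℂ) ∈ Submodule.span ℂ (CombG H ord) := by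
    have := Submodule.smul_mem _ ((d / nrm H ord : ℝ) : ℂ)
      (Submodule.subset_span (R := ℂ) (CombG_scalar (H := H) ord))
    rw [← Complex.coe_smul, smul_smul, ← Complex.ofReal_mul, div_mul_div_cancel₀ hn.ne',
      div_self hc.ne'] at this
    simpa using this
  obtain ⟨r, hr, hp⟩ := exists_shift Q hH
  obtain ⟨r', hr', hp'⟩ : ∃ r' : ℝ, 0 < r' ∧ 
      0 < r' * d + (r • (1 : Matrix (∀ i, H i) (∀ i, H i) ℂ) + Q).trace.re := by
    have h0 := (Complex.le_def.mp hp.trace_nonneg).1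
    exact ⟨1, one_pos, by simp only [Complex.zero_re] at h0; linarith⟩
  set T := r' • (1 : Matrix (∀ i, H i) (∀ i, H i) ℂ) + (r • 1 + Q) with hT
  have hTp : T.PosSemidef := (Matrix.PosSemidef.one.smul hr'.le).add hp
  have hTt : T.trace = ((T.trace.re : ℝ) : ℂ) := by
    have := (Complex.le_def.mp hTp.trace_nonneg).2
    refine Complex.ext (Complex.ofReal_re _).symm ?_
    rw [← this, Complex.ofReal_im, Complex.zero_im]
  have hTpos : 0 < T.trace.re := by
    have : T.trace.re = r' * d + (r • (1 : Matrix (∀ i, H i) (∀ i, H i) ℂ) + Q).trace.re := by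
      rw [hT, Matrix.trace_add, Matrix.trace_smul, Matrix.trace_one, Complex.add_re,
        Complex.real_smul, Complex.re_ofReal_mul, Complex.natCast_re]
    rw [this]; exact hp'
  set t := T.trace.re
  have hmem : ((nrm H ord / t) • T) ∈ CombG H ord := by
    refine ⟨hTp.smul (by positivity), ((Chain.one.rsmul _).add ((Chain.one.rsmul _).add hQ)).rsmul _, ?_⟩
    rw [Matrix.trace_smul, hTt, Complex.real_smul, ← Complex.ofReal_mul, div_mul_cancel₀ _ hTpos.ne']
  have h2 : T ∈ Submodule.span ℂ (CombG H ord) := by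
    have := Submodule.smul_mem _ ((t / nrm H ord : ℝ) : ℂ) (Submodule.subset_span (R := ℂ) hmem)
    rw [← Complex.coe_smul, smul_smul, ← Complex.ofReal_mul, div_mul_div_cancel₀ hn.ne',
      div_self hTpos.ne'] at this
    simpa using this
  have : Q = T - ((r' : ℂ) • (1 : Matrix (∀ i, H i) (∀ i, H i) ℂ) + (r : ℂ) • 1) := by
    rw [hT, Complex.coe_smul, Complex.coe_smul]; abel
  rw [this]
  exact Submodule.sub_mem _ h2 (Submodule.add_mem _ (Submodule.smul_mem _ _ h1)
    (Submodule.smul_mem _ _ h1))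

theorem chain_span [∀ i, Nonempty (H i)] {ord : ι → ℕ}
    {P : Matrix (∀ i, H i) (∀ i, H i) ℂ} (hP : Chain ord P) :
    P ∈ Submodule.span ℂ (CombG H ord) := by
  have h1 := chain_herm_span (hP.add hP.conjTranspose) (by
    rw [Matrix.IsHermitian, Matrix.conjTranspose_add, Matrix.conjTranspose_conjTranspose, add_comm])
  have h2 := chain_herm_span ((hP.sub hP.conjTranspose).smul Complex.I) (by
    rw [Matrix.IsHermitian, Matrix.conjTranspose_smul, Matrix.conjTranspose_sub,
      Matrix.conjTranspose_conjTranspose]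
    simp only [RCLike.star_def, Complex.conj_I, neg_smul, ← smul_neg, neg_sub])
  have : P = (1/2 : ℂ) • (P + Pᴴ) - (Complex.I / 2) • (Complex.I • (P - Pᴴ)) := by
    have hI : Complex.I / 2 * Complex.I = - (1/2) := by
      rw [div_mul_eq_mul_div, Complex.I_mul_I]; norm_num
    rw [smul_smul, hI, neg_smul, sub_neg_eq_add, ← smul_add]
    ext x y; simp; ring
  rw [this]
  exact Submodule.sub_mem _ (Submodule.smul_mem _ _ h1) (Submodule.smul_mem _ _ h2)

end General


section Reindex

variable {ι κ : Type} [Fintype ι] [DecidableEq ι] [Fintype κ] [DecidableEq κ]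
  {H : ι → Type} {K : κ → Type}
  [∀ i, Fintype (H i)] [∀ i, DecidableEq (H i)] [∀ i, Fintype (K i)] [∀ i, DecidableEq (K i)]

theorem trace_reindex' {α β : Type} [Fintype α] [Fintype β] (E : α ≃ β) (M : Matrix α α ℂ) :
    (Matrix.reindex E E M).trace = M.trace := by
  simp only [Matrix.trace, Matrix.diag, Matrix.reindex_apply, Matrix.submatrix_apply]
  exact Equiv.sum_comp E.symm (fun i => M i i)

theorem reindex_mul' {α β : Type} [Fintype α] [Fintype β] (E : α ≃ β) (M N : Matrix α α ℂ) :
    Matrix.reindex E E (M * N) = Matrix.reindex E E M * Matrix.reindex E E N := by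
  simp only [Matrix.reindex_apply]
  exact (Matrix.submatrix_mul_equiv M N _ E.symm _).symm

theorem psd_reindex {α β : Type} [Fintype α] [Fintype β] (E : α ≃ β) (M : Matrix α α ℂ) :
    (Matrix.reindex E E M).PosSemidef ↔ M.PosSemidef := by
  rw [Matrix.reindex_apply]
  exact Matrix.posSemidef_submatrix_equiv _

theorem ph_reindex (e : κ ≃ ι) (f : ∀ k, H (e k) ≃ K k) (E : (∀ i, H i) ≃ (∀ k, K k))
    (hE : ∀ u k, E u k = f k (u (e k))) (R : Matrix (∀ i, H i) (∀ i, H i) ℂ)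
    (X : ∀ i, Matrix (H i) (H i) ℂ) (X' : ∀ k, Matrix (K k) (K k) ℂ)
    (hX : ∀ k, X (e k) = (X' k).submatrix (f k) (f k)) :
    ph (Matrix.reindex E E R) X' = ph R X := by
  have : Matrix.reindex E E (prodOp X) = prodOp X' := by
    ext u v
    obtain ⟨u, rfl⟩ := E.surjective u
    obtain ⟨v, rfl⟩ := E.surjective v
    simp only [Matrix.reindex_apply, Matrix.submatrix_apply, Equiv.symm_apply_apply, prodOp, hE]
    rw [← Equiv.prod_comp e]
    simp [hX]
  rw [ph, ph, ← this, ← reindex_mul', trace_reindex']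

theorem CombG_reindex (e : κ ≃ ι) (f : ∀ k, H (e k) ≃ K k) (E : (∀ i, H i) ≃ (∀ k, K k))
    (hE : ∀ u k, E u k = f k (u (e k))) (ord : ι → ℕ) (ord' : κ → ℕ)
    (ho : ∀ k, ord' k = ord (e k)) (R : Matrix (∀ i, H i) (∀ i, H i) ℂ) :
    Matrix.reindex E E R ∈ CombG K ord' ↔ R ∈ CombG H ord := by
  have hn : nrm K ord' = nrm H ord := by
    unfold nrm
    rw [← Equiv.prod_comp e]
    refine Finset.prod_congr rfl fun k _ => ?_
    rw [ho, Fintype.card_congr (f k)]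
  unfold CombG
  simp only [Set.mem_ofPred_eq, psd_reindex, trace_reindex', hn]
  refine and_congr_right fun _ => and_congr_left fun _ => ⟨fun h X j a b c => ?_, fun h X' j a b c => ?_⟩
  · rw [← ph_reindex e f E hE R X (fun k => (X (e k)).submatrix (f k).symm (f k).symm)
      (fun k => by ext; simp)]
    obtain ⟨j, rfl⟩ := e.surjective j
    refine h _ j (by rwa [ho]) ?_ fun i hi => ?_
    · exact (trace_reindex' (f j) (X (e j))).trans b
    · rw [c (e i) (by rwa [ho, ho] at hi), Matrix.submatrix_one_equiv]
  · have hX := fun k => Equiv.piCongrLeft_apply_apply (fun i => Matrix (H i) (H i) ℂ) e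
      (fun k => (X' k).submatrix (f k) (f k)) k
    rw [ph_reindex e f E hE R _ X' hX]
    refine h _ (e j) (by rwa [← ho]) ?_ fun i hi => ?_
    · rw [hX]; exact (trace_reindex' (f j).symm (X' j)).trans b
    · obtain ⟨i, rfl⟩ := e.surjective i
      rw [hX, c i (by rwa [ho, ho]), Matrix.submatrix_one_equiv]

end Reindex

section Ends

variable (H : ℕ → Type) [∀ j, Fintype (H j)] [∀ j, DecidableEq (H j)]

theorem reindex_splitEnds_prodOp (k : ℕ) (X : ∀ j : Fin (k + 2), Matrix (H j) (H j) ℂ) :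
    Matrix.reindex (splitEnds H k) (splitEnds H k) (prodOp X) =
      (show Matrix (H 0) (H 0) ℂ from X ⟨0, by omega⟩) ⊗ₖ
      ((prodOp (H := fun j : Fin k => H (j + 1)) (fun j => X ⟨(j : ℕ) + 1, by omega⟩)) ⊗ₖ
      (show Matrix (H (k+1)) (H (k+1)) ℂ from X ⟨k + 1, by omega⟩)) := by
  ext u v
  obtain ⟨u, rfl⟩ := (splitEnds H k).surjective u
  obtain ⟨v, rfl⟩ := (splitEnds H k).surjective v
  simp only [Matrix.reindex_apply, Matrix.submatrix_apply, Equiv.symm_apply_apply]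
  rw [prodOp, Fin.prod_univ_succ, Fin.prod_univ_castSucc]
  rfl

/-- pairing -/
def pairE (k : ℕ) (R : Matrix (∀ j : Fin (k + 2), H j) (∀ j : Fin (k + 2), H j) ℂ)
    (X : Matrix (H 0) (H 0) ℂ)
    (S : Matrix (∀ j : Fin k, H (j + 1)) (∀ j : Fin k, H (j + 1)) ℂ) : ℂ :=
  ((X ⊗ₖ (S ⊗ₖ (1 : Matrix (H (k + 1)) (H (k + 1)) ℂ))) *
    (Matrix.reindex (splitEnds H k) (splitEnds H k) R)).trace

theorem ph_eq_pairE (k : ℕ) (R : Matrix (∀ j : Fin (k + 2), H j) (∀ j : Fin (k + 2), H j) ℂ)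
    (X : ∀ j : Fin (k + 2), Matrix (H j) (H j) ℂ) (hX : X ⟨k + 1, by omega⟩ = 1) :
    ph R X = pairE H k R (X ⟨0, by omega⟩)
      (prodOp (H := fun j : Fin k => H (j + 1)) (fun j => X ⟨(j : ℕ) + 1, by omega⟩)) := by
  have := reindex_splitEnds_prodOp H k X
  rw [hX] at this
  rw [pairE, ph, Matrix.trace_mul_comm, ← trace_reindex' (splitEnds H k), reindex_mul', this]

theorem pairE_trace {α β γ : Type} [Fintype α] [Fintype β] [Fintype γ] [DecidableEq α]
    [DecidableEq β] [DecidableEq γ] (X : Matrix α α ℂ) (S : Matrix β β ℂ)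
    (W : Matrix (α × β × γ) (α × β × γ) ℂ) :
    ((X ⊗ₖ (S ⊗ₖ (1 : Matrix γ γ ℂ))) * W).trace =
      (X * (Matrix.of fun a a' => ∑ b, ptrMid (((1 : Matrix α α ℂ) ⊗ₖ (S ⊗ₖ (1 : Matrix γ γ ℂ))) * W)
        (a, b) (a', b))).trace := by
  have h : X ⊗ₖ (S ⊗ₖ (1 : Matrix γ γ ℂ)) =
      (X ⊗ₖ ((1 : Matrix β β ℂ) ⊗ₖ (1 : Matrix γ γ ℂ))) *
        ((1 : Matrix α α ℂ) ⊗ₖ (S ⊗ₖ (1 : Matrix γ γ ℂ))) := by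
    rw [← Matrix.mul_kronecker_mul, ← Matrix.mul_kronecker_mul]; simp
  rw [h, mul_assoc]
  generalize (((1 : Matrix α α ℂ) ⊗ₖ (S ⊗ₖ (1 : Matrix γ γ ℂ))) * W) = V
  rw [Matrix.one_kronecker_one]
  simp only [Matrix.trace, Matrix.diag, Matrix.mul_apply, Matrix.kroneckerMap_apply, ptrMid,
    Fintype.sum_prod_type, Matrix.one_apply, Matrix.of_apply, Prod.mk.injEq]
  refine Finset.sum_congr rfl fun a _ => ?_
  simp only [Finset.mul_sum]
  have : ∀ b c, ∑ a', ∑ b', ∑ c', X a a' * (if b = b' ∧ c = c' then 1 else 0) *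
      V (a', b', c') (a, b, c) = ∑ a', X a a' * V (a', b, c) (a, b, c) := by
    intro b c
    refine Finset.sum_congr rfl fun a' _ => ?_
    rw [Finset.sum_eq_single b, Finset.sum_eq_single c]
    · simp
    · intro x _ hx; simp [hx.symm]
    · simp
    · intro x _ hx; simp [hx.symm]
    · simp
  simp only [this]
  rw [Finset.sum_comm, Finset.sum_congr rfl fun c _ => Finset.sum_comm, Finset.sum_comm]

theorem ext_trace {α : Type} [Fintype α] [DecidableEq α] (M : Matrix α α ℂ) :
    M = 1 ↔ ∀ X : Matrix α α ℂ, (X * M).trace = X.trace := by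
  refine ⟨fun h X => by rw [h, mul_one], fun h => ?_⟩
  refine Matrix.ext_iff_trace_mul_left.mpr fun X => ?_
  rw [h, mul_one]

theorem psd_ptrMid {α β γ : Type} [Fintype α] [Fintype β] [Fintype γ] [DecidableEq α]
    [DecidableEq β] [DecidableEq γ] {S : Matrix β β ℂ} (hS : S.PosSemidef)
    {W : Matrix (α × β × γ) (α × β × γ) ℂ} (hW : W.PosSemidef) :
    (ptrMid (((1 : Matrix α α ℂ) ⊗ₖ (S ⊗ₖ (1 : Matrix γ γ ℂ))) * W)).PosSemidef := by
  obtain ⟨C, rfl⟩ := by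
    open scoped MatrixOrder in
    exact CStarAlgebra.nonneg_iff_eq_star_mul_self.mp hS.nonneg
  have hcyc : ∀ (D : Matrix β β ℂ) (V : Matrix (α × β × γ) (α × β × γ) ℂ),
      ptrMid (((1 : Matrix α α ℂ) ⊗ₖ (D ⊗ₖ (1 : Matrix γ γ ℂ))) * V) =
      ptrMid (V * ((1 : Matrix α α ℂ) ⊗ₖ (D ⊗ₖ (1 : Matrix γ γ ℂ)))) := by
    intro D V
    ext ⟨a, c⟩ ⟨a', c'⟩
    simp only [ptrMid, Matrix.mul_apply, Matrix.kroneckerMap_apply, Fintype.sum_prod_type,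
      Matrix.one_apply]
    simp only [ite_mul, mul_ite, one_mul, zero_mul, mul_one, mul_zero, Finset.sum_ite_irrel,
      Finset.sum_ite_eq, Finset.sum_ite_eq', Finset.sum_const_zero, Finset.mem_univ, if_true]
    rw [Finset.sum_comm]
    simp only [mul_comm]
  have h1 : (1 : Matrix α α ℂ) ⊗ₖ ((star C * C) ⊗ₖ (1 : Matrix γ γ ℂ)) =
      ((1 : Matrix α α ℂ) ⊗ₖ (star C ⊗ₖ (1 : Matrix γ γ ℂ))) *
      ((1 : Matrix α α ℂ) ⊗ₖ (C ⊗ₖ (1 : Matrix γ γ ℂ))) := by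
    rw [← Matrix.mul_kronecker_mul, ← Matrix.mul_kronecker_mul]; simp
  have h2 : (1 : Matrix α α ℂ) ⊗ₖ (star C ⊗ₖ (1 : Matrix γ γ ℂ)) =
      ((1 : Matrix α α ℂ) ⊗ₖ (C ⊗ₖ (1 : Matrix γ γ ℂ)))ᴴ := by
    rw [Matrix.conjTranspose_kronecker, Matrix.conjTranspose_kronecker]; simp [Matrix.star_eq_conjTranspose]
  rw [h1, mul_assoc, hcyc, h2]
  have h3 := hW.mul_mul_conjTranspose_same ((1 : Matrix α α ℂ) ⊗ₖ (C ⊗ₖ (1 : Matrix γ γ ℂ)))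
  generalize ((1 : Matrix α α ℂ) ⊗ₖ (C ⊗ₖ (1 : Matrix γ γ ℂ))) * W *
    ((1 : Matrix α α ℂ) ⊗ₖ (C ⊗ₖ (1 : Matrix γ γ ℂ)))ᴴ = V at h3
  have : ptrMid V = ∑ b : β, V.submatrix (fun p : α × γ => (p.1, b, p.2)) (fun p => (p.1, b, p.2)) := by
    ext p q
    simp [ptrMid, Matrix.sum_apply]
  rw [this]
  exact Matrix.posSemidef_sum _ fun b _ => h3.submatrix _

theorem Comb_psd : ∀ (n : ℕ) (H : ℕ → Type) [∀ j, Fintype (H j)] [∀ j, DecidableEq (H j)] (S),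
    S ∈ Comb n H → S.PosSemidef
  | 0, _, _, _, _, h => by simp [Comb] at h
  | 1, _, _, _, _, h => by rw [Comb] at h; exact h.1
  | (n + 2), _, _, _, _, h => by rw [Comb] at h; exact h.1

theorem Comb_succ_iff (n : ℕ) (R : Matrix (∀ j : Fin (2 * (n + 2)), H j) (∀ j : Fin (2 * (n + 2)), H j) ℂ) :
    R ∈ Comb (n + 2) H ↔ R.PosSemidef ∧ ∀ S ∈ Comb (n + 1) (fun j => H (j + 1)),
      ∀ X, pairE H (2 * (n + 1)) R X S = X.trace := by
  rw [Comb, Set.mem_ofPred_eq]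
  refine and_congr_right fun hR => forall₂_congr fun S hS => ?_
  have hp := psd_ptrMid (α := H 0) (γ := H (2 * (n + 1) + 1)) (Comb_psd _ _ _ hS)
    ((psd_reindex (splitEnds H (2 * (n + 1))) R).mpr hR)
  rw [comb1Set, Set.mem_ofPred_eq, and_iff_right hp]
  refine (ext_trace _).trans (forall_congr' fun X => ?_)
  rw [pairE, pairE_trace]
  rfl

theorem Comb_one_iff (R : Matrix (∀ j : Fin (2 * 1), H j) (∀ j : Fin (2 * 1), H j) ℂ) :
    R ∈ Comb 1 H ↔ R.PosSemidef ∧ ∀ X, pairE H 0 R X 1 = X.trace := by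
  rw [Comb, Set.mem_ofPred_eq]
  refine and_congr_right fun hR => ?_
  have this := ext_trace (Matrix.of fun a a' => ∑ b, ptrMid (((1 : Matrix (H 0) (H 0) ℂ) ⊗ₖ
      ((1 : Matrix (∀ j : Fin 0, H (j + 1)) (∀ j : Fin 0, H (j + 1)) ℂ) ⊗ₖ
        (1 : Matrix (H 1) (H 1) ℂ))) *
        (Matrix.reindex (splitEnds H 0) (splitEnds H 0) R))
        (a, b) (a', b))
  refine Iff.trans ?_ (this.trans (forall_congr' fun X => by rw [pairE, pairE_trace]))
  rw [← Matrix.ext_iff, ← Matrix.ext_iff]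
  have hs : ∀ (u : ∀ j : Fin 1, H j) (b : H 1), (splitEnds H 0).symm (u 0, default, b) =
      Fin.snoc (α := fun j : Fin 2 => H j) u b := by
    intro u b
    rw [Equiv.symm_apply_eq]
    refine Prod.ext ?_ (Prod.ext ?_ ?_)
    · rfl
    · exact Subsingleton.elim _ _
    · rfl
  simp only [trLast, ptrMid, Matrix.of_apply, Matrix.one_kronecker_one, one_mul,
    Matrix.reindex_apply, Matrix.submatrix_apply, Fintype.sum_unique]
  constructor
  · intro h a a'
    have := h (fun j => (Subsingleton.elim 0 j) ▸ a) (fun j => (Subsingleton.elim 0 j) ▸ a')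
    simp only [← hs] at this
    refine this.trans ?_
    simp only [Matrix.one_apply]
    refine if_congr ?_ rfl rfl
    refine ⟨fun h => congrFun h 0, fun h => by rw [h]⟩
  · intro h u v
    have := h (u 0) (v 0)
    simp only [hs] at this
    refine this.trans ?_
    simp only [Matrix.one_apply]
    refine if_congr ?_ rfl rfl
    refine ⟨fun h => ?_, fun h => by rw [h]⟩
    funext j
    obtain rfl : j = 0 := Subsingleton.elim _ _
    exact h

end Ends


section Step

variable (H : ℕ → Type) [∀ j, Fintype (H j)] [∀ j, DecidableEq (H j)]

theorem pairE_add_right (k : ℕ) (R : Matrix (∀ j : Fin (k + 2), H j) (∀ j : Fin (k + 2), H j) ℂ)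
    (X S T) : pairE H k R X (S + T) = pairE H k R X S + pairE H k R X T := by
  simp [pairE, Matrix.add_kronecker, Matrix.kronecker_add, add_mul]

theorem pairE_smul_right (k : ℕ) (R : Matrix (∀ j : Fin (k + 2), H j) (∀ j : Fin (k + 2), H j) ℂ)
    (X S) (c : ℂ) : pairE H k R X (c • S) = c * pairE H k R X S := by
  simp [pairE, Matrix.smul_kronecker, Matrix.kronecker_smul]

theorem pairE_zero_right (k : ℕ) (R : Matrix (∀ j : Fin (k + 2), H j) (∀ j : Fin (k + 2), H j) ℂ)
    (X) : pairE H k R X 0 = 0 := by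
  have := pairE_smul_right H k R X 0 0
  rwa [zero_smul, zero_mul] at this

theorem pairE_sum_right (k : ℕ) (R : Matrix (∀ j : Fin (k + 2), H j) (∀ j : Fin (k + 2), H j) ℂ)
    (X) {τ : Type} (s : Finset τ) (f : τ → Matrix (∀ j : Fin k, H (j + 1)) (∀ j : Fin k, H (j + 1)) ℂ) :
    pairE H k R X (∑ t ∈ s, f t) = ∑ t ∈ s, pairE H k R X (f t) := by
  classical
  induction s using Finset.induction_on with
  | empty => simp [pairE_zero_right]
  | insert a s ha ih => rw [Finset.sum_insert ha, Finset.sum_insert ha, pairE_add_right, ih]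

theorem pairE_add_left (k : ℕ) (R : Matrix (∀ j : Fin (k + 2), H j) (∀ j : Fin (k + 2), H j) ℂ)
    (X Y S) : pairE H k R (X + Y) S = pairE H k R X S + pairE H k R Y S := by
  simp [pairE, Matrix.add_kronecker, Matrix.kronecker_add, add_mul]

theorem pairE_smul_left (k : ℕ) (R : Matrix (∀ j : Fin (k + 2), H j) (∀ j : Fin (k + 2), H j) ℂ)
    (X S) (c : ℂ) : pairE H k R (c • X) S = c * pairE H k R X S := by
  simp [pairE, Matrix.smul_kronecker, Matrix.kronecker_smul]

theorem pairE_one (k : ℕ) (R : Matrix (∀ j : Fin (k + 2), H j) (∀ j : Fin (k + 2), H j) ℂ) :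
    pairE H k R 1 1 = R.trace := by
  rw [pairE, Matrix.one_kronecker_one, Matrix.one_kronecker_one, one_mul, trace_reindex']

theorem nrm_step (k : ℕ) (hk : Even k) :
    nrm (fun j : Fin (k + 2) => H j) Fin.val * nrm (fun j : Fin k => H (j + 1)) Fin.val =
      Fintype.card (H 0) * Fintype.card (∀ j : Fin k, H (j + 1)) := by
  have h1 : ¬ Even (k + 1) := by simpa [Nat.even_add_one] using hk
  unfold nrm
  rw [Fin.prod_univ_succ, Fin.prod_univ_castSucc]
  have e : ∀ i : Fin k, (if Even ((i.castSucc.succ : Fin (k+2)) : ℕ) then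
      (Fintype.card (H ((i.castSucc.succ : Fin (k+2)) : ℕ)) : ℝ) else 1) *
      (if Even (i : ℕ) then (Fintype.card (H (i + 1)) : ℝ) else 1) = Fintype.card (H (i + 1)) := by
    intro i
    simp only [Fin.val_succ, Fin.val_castSucc, Nat.even_add_one]
    by_cases h : Even (i : ℕ) <;> simp [h]
  simp only [Fin.val_zero, Even.zero, if_true, Fin.val_succ, Fin.val_last, h1, if_false, mul_one]
  rw [mul_assoc]
  congr 1
  rw [← Finset.prod_mul_distrib, Fintype.card_pi, Nat.cast_prod]
  exact Finset.prod_congr rfl fun i _ => e i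

theorem step (k : ℕ) (hk : Even k) (hne : ∀ j, j < k + 2 → Nonempty (H j))
    (R : Matrix (∀ j : Fin (k + 2), H j) (∀ j : Fin (k + 2), H j) ℂ) :
    (∀ S ∈ CombG (fun j : Fin k => H (j + 1)) Fin.val, ∀ X, pairE H k R X S = X.trace) ↔
    (Chain Fin.val R ∧ R.trace = nrm (fun j : Fin (k + 2) => H j) Fin.val) := by
  have i1 : ∀ j : Fin (k + 2), Nonempty (H j) := fun j => hne j j.2
  have i2 : ∀ j : Fin k, Nonempty (H (j + 1)) := fun j => hne _ (by omega)
  have i0 : Nonempty (H 0) := hne 0 (by omega)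
  have hN' := nrm_pos (H := fun j : Fin k => H (j + 1)) Fin.val
  have hst := nrm_step H k hk
  have hd0 : (Fintype.card (H 0) : ℂ) ≠ 0 := by exact_mod_cast Fintype.card_ne_zero
  have hdm : (Fintype.card (∀ j : Fin k, H (j + 1)) : ℂ) ≠ 0 := by
    exact_mod_cast Fintype.card_ne_zero
  set N := nrm (fun j : Fin (k + 2) => H j) Fin.val with hNd
  set N' := nrm (fun j : Fin k => H (j + 1)) Fin.val with hNd'
  have hstC : (N : ℂ) * N' = Fintype.card (H 0) * Fintype.card (∀ j : Fin k, H (j + 1)) := by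
    exact_mod_cast hst
  have hN'C : (N' : ℂ) ≠ 0 := by exact_mod_cast hN'.ne'
  constructor
  · intro h
    have hs : ∀ P : Matrix (∀ j : Fin k, H (j + 1)) (∀ j : Fin k, H (j + 1)) ℂ,
        Chain Fin.val P → ∀ X, N' * pairE H k R X P = P.trace * X.trace := by
      intro P hP X
      have hP' := chain_span hP
      clear hP
      induction hP' using Submodule.span_induction with
      | mem S hS => rw [h S hS, hS.2.2]
      | zero => simp [pairE_zero_right]
      | add S T _ _ h1 h2 => rw [pairE_add_right, mul_add, h1, h2, Matrix.trace_add, add_mul]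
      | smul c S _ h1 =>
        rw [pairE_smul_right, Matrix.trace_smul, smul_eq_mul, mul_left_comm, h1, mul_assoc]
    refine ⟨fun Y j hj h0 h1 => ?_, ?_⟩
    · have hjl : (j : ℕ) < k + 1 := by
        have : (j : ℕ) ≠ k + 1 := by
          intro hh; rw [hh, Nat.even_add_one] at hj; exact hj hk
        omega
      rw [ph_eq_pairE H k R Y (h1 _ hjl)]
      refine (mul_eq_zero.mp (?_ : (N' : ℂ) * _ = 0)).resolve_left hN'C
      by_cases hj0 : (j : ℕ) = 0
      · obtain ⟨j, hjlt⟩ := j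
        obtain rfl : j = 0 := hj0
        have : (fun j : Fin k => Y ⟨(j : ℕ) + 1, by omega⟩) = fun j => 1 := by
          funext i
          exact h1 _ (Nat.succ_pos _)
        rw [this, prodOp_one, hs _ Chain.one, h0, mul_zero]
      · obtain ⟨i, hi⟩ : ∃ i, (j : ℕ) = i + 1 := ⟨j - 1, by omega⟩
        have hik : i < k := by omega
        obtain ⟨j, hjlt⟩ := j
        obtain rfl : j = i + 1 := hi
        simp only [Nat.even_add_one] at hj
        rw [hs, trace_prodOp, Finset.prod_eq_zero (Finset.mem_univ (⟨i, hik⟩ : Fin k)) h0, zero_mul]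
        intro Z l hl hz1 hz2
        rw [ph_prodOp]
        rcases lt_trichotomy (l : ℕ) i with hli | hli | hli
        · refine Finset.prod_eq_zero (Finset.mem_univ (⟨i, hik⟩ : Fin k)) ?_
          rw [hz2 _ hli, mul_one]
          exact h0
        · rw [hli] at hl; exact absurd hl hj
        · refine Finset.prod_eq_zero (Finset.mem_univ l) ?_
          rw [h1 _ (Nat.succ_lt_succ hli : i + 1 < (l : ℕ) + 1)]
          exact (congrArg Matrix.trace (one_mul (Z l))).trans hz1
    · have := hs 1 Chain.one 1
      rw [pairE_one, Matrix.trace_one, Matrix.trace_one, mul_comm (Fintype.card _ : ℂ), ← hstC,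
        mul_comm (N : ℂ)] at this
      exact mul_left_cancel₀ hN'C this
  · rintro ⟨hR, hRt⟩ S hS X
    -- pairing with product operators
    have hpp : ∀ (X : Matrix (H 0) (H 0) ℂ) (P : ∀ j : Fin k, Matrix (H (j + 1)) (H (j + 1)) ℂ),
        ∃ Y : ∀ j : Fin (k + 2), Matrix (H j) (H j) ℂ, Y ⟨0, by omega⟩ = X ∧
          (∀ j : Fin k, Y ⟨(j : ℕ) + 1, by omega⟩ = P j) ∧ Y ⟨k + 1, by omega⟩ = 1 ∧
          ph R Y = pairE H k R X (prodOp P) := by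
      intro X P
      have hY := (splitEnds (fun j => Matrix (H j) (H j) ℂ) k).apply_symm_apply (X, P, 1)
      set Y := (splitEnds (fun j => Matrix (H j) (H j) ℂ) k).symm (X, P, 1)
      have a1 : Y ⟨0, by omega⟩ = X := congrArg Prod.fst hY
      have a2 : ∀ j : Fin k, Y ⟨(j : ℕ) + 1, by omega⟩ = P j :=
        fun j => congrFun (congrArg (fun t => t.2.1) hY) j
      have a3 : Y ⟨k + 1, by omega⟩ = 1 := congrArg (fun t => t.2.2) hY
      refine ⟨Y, a1, a2, a3, ?_⟩
      rw [ph_eq_pairE H k R Y a3, a1]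
      congr 2
      funext j
      exact a2 j
    have hX1 : ∀ X : Matrix (H 0) (H 0) ℂ, Fintype.card (H 0) * pairE H k R X 1 = X.trace * N := by
      intro X
      have : ∀ Z : Matrix (H 0) (H 0) ℂ, Z.trace = 0 → pairE H k R Z 1 = 0 := by
        intro Z hZ
        obtain ⟨Y, y1, y2, y3, hY⟩ := hpp Z (fun _ => 1)
        rw [prodOp_one] at hY
        rw [← hY]
        refine hR Y ⟨0, by omega⟩ (by simp) (by rw [y1]; exact hZ) fun i hi => ?_
        have hi' : 0 < (i : ℕ) := hi
        by_cases hik : (i : ℕ) = k + 1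
        · obtain ⟨i, hilt⟩ := i
          obtain rfl : i = k + 1 := hik
          exact y3
        · obtain ⟨l, hl⟩ : ∃ l, (i : ℕ) = l + 1 := ⟨i - 1, by omega⟩
          have hlk : l < k := by have := i.isLt; omega
          obtain ⟨i, hilt⟩ := i
          obtain rfl : i = l + 1 := hl
          exact y2 ⟨l, hlk⟩
      have h2 : X = (X - (X.trace / Fintype.card (H 0)) • 1) + (X.trace / Fintype.card (H 0)) • 1 := by
        simp
      conv_lhs => rw [h2]
      rw [pairE_add_left, this, pairE_smul_left, pairE_one, hRt]
      · field_simp; ring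
      · rw [Matrix.trace_sub, Matrix.trace_smul, Matrix.trace_one, smul_eq_mul]
        field_simp; ring
    have hexp := expand S
    rw [hexp, pairE_sum_right, Finset.sum_eq_single (fun _ => none)]
    · have : (prodOp fun i : Fin k => fb (H (i + 1)) none)ᵀ = 1 := by
        have := prodOp_one (H := fun i : Fin k => H (i + 1))
        rw [← Matrix.transpose_one, ← this]; rfl
      rw [pairE_smul_right, this]
      have h3 : ph S (fun i : Fin k => fb (H (i + 1)) none) = N' := by
        rw [← hS.2.2]; exact ph_one S
      have h4 : ∏ i : Fin k, fw (H (i + 1)) none =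
          (Fintype.card (∀ j : Fin k, H (j + 1)) : ℂ)⁻¹ := by
        rw [Fintype.card_pi, Nat.cast_prod, ← Finset.prod_inv_distrib]; rfl
      rw [h3, h4]
      have h5 := hX1 X
      have h6 : pairE H k R X 1 = X.trace * N / Fintype.card (H 0) := by
        rw [eq_div_iff hd0, ← h5, mul_comm]
      rw [h6]
      field_simp
      linear_combination X.trace * hstC
    · intro γ _ hγ
      rw [pairE_smul_right]
      obtain ⟨i0, hi0⟩ : ∃ i, γ i ≠ none := by
        by_contra hc; push Not at hc; exact hγ (funext hc)
      obtain ⟨j, hj, hmax⟩ := Finset.exists_max_image (Finset.univ.filter fun i => γ i ≠ none)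
        (fun i : Fin k => (i : ℕ)) ⟨i0, by simp [hi0]⟩
      simp only [Finset.mem_filter, Finset.mem_univ, true_and] at hj hmax
      have hlast : ∀ i : Fin k, (j : ℕ) < i → γ i = none := by
        intro i hi
        by_contra hc
        exact absurd (hmax i hc) (by omega)
      by_cases hev : Even (j : ℕ)
      · rw [hS.2.1 _ j hev (fb_trace _ _ hj) (fun i hi => by rw [hlast i hi]; rfl)]
        simp
      · rw [prodOp_transpose]
        obtain ⟨Y, y1, y2, y3, hY⟩ := hpp X (fun i => (fb (H (i + 1)) (γ i))ᵀ)
        rw [← hY, hR Y ⟨j + 1, by omega⟩ (by simpa [Nat.even_add_one] using hev), mul_zero]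
        · rw [y2 j, Matrix.trace_transpose, fb_trace _ _ hj]
        · intro i hi
          have hi' : (j : ℕ) + 1 < (i : ℕ) := hi
          by_cases hik : (i : ℕ) = k + 1
          · obtain ⟨i, hilt⟩ := i
            obtain rfl : i = k + 1 := hik
            exact y3
          · obtain ⟨l, hl⟩ : ∃ l, (i : ℕ) = l + 1 := ⟨i - 1, by omega⟩
            have hlk : l < k := by have := i.isLt; omega
            obtain ⟨i, hilt⟩ := i
            obtain rfl : i = l + 1 := hl
            rw [y2 ⟨l, hlk⟩, hlast ⟨l, hlk⟩ (by simp at hi' ⊢; omega)]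
            exact Matrix.transpose_one
    · simp

theorem Comb_eq : ∀ (n : ℕ) (H : ℕ → Type) [∀ j, Fintype (H j)] [∀ j, DecidableEq (H j)],
    (∀ j, j < 2 * (n + 1) → Nonempty (H j)) →
      Comb (n + 1) H = CombG (fun j : Fin (2 * (n + 1)) => H j) Fin.val
  | 0, H, _, _, hne => by
    ext R
    rw [Comb_one_iff, CombG, Set.mem_ofPred_eq]
    refine and_congr_right fun hR => ?_
    rw [← step H 0 (by simp) hne R]
    have : CombG (fun j : Fin 0 => H (j + 1)) Fin.val = {1} := by
      ext S
      have h1 : (1 : Matrix (∀ j : Fin 0, H (j + 1)) (∀ j : Fin 0, H (j + 1)) ℂ) ∈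
          CombG (fun j : Fin 0 => H (j + 1)) Fin.val :=
        ⟨Matrix.PosSemidef.one, Chain.one, by simp [nrm]⟩
      refine ⟨fun h => ?_, fun h => by rw [h]; exact h1⟩
      have h2 := h.2.2.trans h1.2.2.symm
      ext u v
      obtain rfl : u = default := Subsingleton.elim _ _
      obtain rfl : v = default := Subsingleton.elim _ _
      simpa [Matrix.trace] using h2
    rw [this]
    simp
  | (n + 1), H, _, _, hne => by
    ext R
    rw [Comb_succ_iff, CombG, Set.mem_ofPred_eq]
    refine and_congr_right fun hR => ?_
    rw [Comb_eq n (fun j => H (j + 1)) (fun j hj => hne _ (by omega))]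
    exact step H (2 * (n + 1)) (by simp) hne R

end Step


section Main

theorem Comb_eq' (p : ℕ) (hp : 1 ≤ p) (H : ℕ → Type) [∀ j, Fintype (H j)] [∀ j, DecidableEq (H j)]
    (hne : ∀ j, j < 2 * p → Nonempty (H j)) :
    Comb p H = CombG (fun j : Fin (2 * p) => H j) Fin.val := by
  obtain ⟨q, rfl⟩ : ∃ q, p = q + 1 := ⟨p - 1, by omega⟩
  exact Comb_eq q H hne

theorem toothReorder_symm_val {p : ℕ} (σ : Equiv.Perm (Fin p)) (i : Fin (2 * p)) :
    ((toothReorder σ).symm i : ℕ) = 2 * (σ ⟨(i : ℕ) / 2, by omega⟩ : ℕ) + (i : ℕ) % 2 := rfl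

theorem toothReorder_val {p : ℕ} (σ : Equiv.Perm (Fin p)) (i : Fin (2 * p)) :
    (toothReorder σ i : ℕ) = 2 * (σ.symm ⟨(i : ℕ) / 2, by omega⟩ : ℕ) + (i : ℕ) % 2 := rfl

/-- positions -/
def ordS (m n : ℕ) (σ : Equiv.Perm (Fin (m + n))) (i : Fin (2 * m + 2 * n)) : ℕ :=
  2 * (σ ⟨(i : ℕ) / 2, by omega⟩ : ℕ) + (i : ℕ) % 2

theorem Kset_eq (m n : ℕ) (hm : 1 ≤ m) (H : ℕ → Type) [∀ j, Fintype (H j)]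
    [∀ j, DecidableEq (H j)] (hne : ∀ j, j < 2 * m + 2 * n → Nonempty (H j))
    (σ : Equiv.Perm (Fin (m + n))) :
    Kset m n H σ = CombG (fun j : Fin (2 * m + 2 * n) => H j) (ordS m n σ) := by
  ext R
  rw [Kset, Set.mem_ofPred_eq, Comb_eq' (m + n) (by omega)]
  · rw [CombG_reindex (H := fun j : Fin (2 * m + 2 * n) => H j)
      (K := fun j : Fin (2 * (m + n)) => H (extendPerm (toothReorder σ) j))
      ((toothReorder σ).trans (finCongr (by omega : 2 * (m + n) = 2 * m + 2 * n)))
      (fun k => Equiv.cast (congrArg H (by simp [extendPerm])))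
      _ (fun u k => rfl) (ordS m n σ)]
    · exact ⟨fun h => h.2, fun h => ⟨h.1, h⟩⟩
    · intro k
      have h := toothReorder_symm_val σ (toothReorder σ k)
      rw [Equiv.symm_apply_apply] at h
      exact h
  · intro j hj
    refine hne _ ?_
    rw [extendPerm, dif_pos hj]
    have := (toothReorder σ ⟨j, hj⟩).isLt
    omega

theorem ordS_refl (m n : ℕ) : ordS m n (Equiv.refl _) = Fin.val := by
  funext i
  simp only [ordS, Equiv.refl_apply]
  omega

theorem ordS_swap_lt (m n : ℕ) (i : Fin (2 * m + 2 * n)) (hi : (i : ℕ) < 2 * m) :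
    ordS m n (sigmaSwap m n) i = 2 * n + i := by
  simp only [ordS, sigmaSwap, Equiv.coe_fn_mk]
  rw [if_pos (by omega)]
  omega

theorem ordS_swap_ge (m n : ℕ) (i : Fin (2 * m + 2 * n)) (hi : 2 * m ≤ (i : ℕ)) :
    ordS m n (sigmaSwap m n) i = i - 2 * m := by
  simp only [ordS, sigmaSwap, Equiv.coe_fn_mk]
  rw [if_neg (by omega)]
  omega

theorem even_ordS (m n : ℕ) (σ) (i : Fin (2 * m + 2 * n)) :
    Even (ordS m n σ i) ↔ Even (i : ℕ) := by
  simp only [ordS, Nat.even_iff]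
  omega

variable (H : ℕ → Type) [∀ j, Fintype (H j)] [∀ j, DecidableEq (H j)]

theorem reindex_splitPi_prodOp (a b : ℕ) (X : ∀ j : Fin (a + b), Matrix (H j) (H j) ℂ) :
    Matrix.reindex (splitPi a b H) (splitPi a b H) (prodOp X) =
      (prodOp (H := fun j : Fin a => H j) (fun j => X (Fin.castAdd b j))) ⊗ₖ
      (prodOp (H := fun j : Fin b => H (a + j)) (fun j => X (Fin.natAdd a j))) := by
  ext u v
  obtain ⟨u, rfl⟩ := (splitPi a b H).surjective u
  obtain ⟨v, rfl⟩ := (splitPi a b H).surjective v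
  simp only [Matrix.reindex_apply, Matrix.submatrix_apply, Equiv.symm_apply_apply]
  rw [prodOp, Fin.prod_univ_add]
  rfl

theorem ph_kron (a b : ℕ) (M : Matrix (∀ j : Fin a, H j) (∀ j : Fin a, H j) ℂ)
    (N : Matrix (∀ j : Fin b, H (a + j)) (∀ j : Fin b, H (a + j)) ℂ)
    (X : ∀ j : Fin (a + b), Matrix (H j) (H j) ℂ) :
    ph (Matrix.reindex (splitPi a b H).symm (splitPi a b H).symm (M ⊗ₖ N)) X =
      ph M (fun j => X (Fin.castAdd b j)) *
      ph (H := fun j : Fin b => H (a + j)) N (fun j => X (Fin.natAdd a j)) := by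
  rw [ph, ← trace_reindex' (splitPi a b H), reindex_mul', reindex_splitPi_prodOp,
    ← Matrix.reindex_symm, Equiv.apply_symm_apply, ← Matrix.mul_kronecker_mul,
    Matrix.trace_kronecker]
  rfl

theorem nrm_split (m n : ℕ) : nrm (fun j : Fin (2 * m + 2 * n) => H j) Fin.val =
    nrm (fun j : Fin (2 * m) => H j) Fin.val * nrm (fun j : Fin (2 * n) => H (2 * m + j)) Fin.val := by
  unfold nrm
  rw [Fin.prod_univ_add]
  simp [Nat.even_add]

theorem affine_of_span {α : Type} [Fintype α] [DecidableEq α] (C : Set (Matrix α α ℂ)) (t : ℝ)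
    (ht : t ≠ 0) (hC : ∀ S ∈ C, S.IsHermitian ∧ S.trace = t) (hne : C.Nonempty) (T : Matrix α α ℂ)
    (hT : T.IsHermitian) (hTt : T.trace = t) (hs : T ∈ Submodule.span ℂ C) :
    T ∈ affineSpan ℝ C := by
  have h1 : ∀ c : ℂ, c • T + (c • T)ᴴ ∈ Submodule.span ℝ C := by
    clear hT hTt
    induction hs using Submodule.span_induction with
    | mem S hS =>
      intro c
      have : c • S + (c • S)ᴴ = (2 * c.re) • S := by
        rw [Matrix.conjTranspose_smul, (hC S hS).1, ← add_smul, RCLike.star_def, Complex.add_conj,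
          Complex.coe_smul]
      rw [this]
      exact Submodule.smul_mem _ _ (Submodule.subset_span hS)
    | zero => intro c; simp
    | add S T _ _ h1 h2 =>
      intro c
      have : c • (S + T) + (c • (S + T))ᴴ = (c • S + (c • S)ᴴ) + (c • T + (c • T)ᴴ) := by
        rw [smul_add, Matrix.conjTranspose_add]; abel
      rw [this]
      exact Submodule.add_mem _ (h1 c) (h2 c)
    | smul a S _ h1 =>
      intro c
      rw [smul_smul]
      exact h1 _
  have h2 : T ∈ Submodule.span ℝ C := by
    have := h1 (1/2)
    rw [Matrix.conjTranspose_smul, hT, ← add_smul] at this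
    norm_num at this
    exact this
  obtain ⟨S0, hS0⟩ := hne
  have hS0' := subset_affineSpan ℝ C hS0
  have h3 : T + (1 - T.trace.re / t) • S0 ∈ affineSpan ℝ C := by
    clear hT hTt hs h1
    induction h2 using Submodule.span_induction with
    | mem S hS =>
      rw [(hC S hS).2, Complex.ofReal_re, div_self ht, sub_self, zero_smul, add_zero]
      exact subset_affineSpan ℝ C hS
    | zero => simpa using hS0'
    | add S T _ _ h1 h2 =>
      have := AffineSubspace.smul_vsub_vadd_mem _ (1 : ℝ) h1 hS0' h2
      convert this using 1
      simp only [vsub_eq_sub, vadd_eq_add, Matrix.trace_add, Complex.add_re, one_smul, add_div]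
      module
    | smul a S _ h1 =>
      have := AffineSubspace.smul_vsub_vadd_mem _ a h1 hS0' hS0'
      convert this using 1
      simp only [vsub_eq_sub, vadd_eq_add, Matrix.trace_smul, Complex.real_smul,
        Complex.re_ofReal_mul, mul_div_assoc]
      module
  rw [hTt, Complex.ofReal_re, div_self ht, sub_self, zero_smul, add_zero] at h3
  exact h3

theorem main_nondeg (m n : ℕ) (hm : 1 ≤ m) (hn : 1 ≤ n)
    (hne : ∀ j, j < 2 * m + 2 * n → Nonempty (H j)) :
    Kset m n H (Equiv.refl (Fin (m + n))) ∩ Kset m n H (sigmaSwap m n) =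
      {R : Matrix (∀ j : Fin (2 * m + 2 * n), H j) (∀ j : Fin (2 * m + 2 * n), H j) ℂ |
        R.PosSemidef ∧
        Matrix.reindex (splitPi (2 * m) (2 * n) H) (splitPi (2 * m) (2 * n) H) R ∈
          affineSpan ℝ (Set.image2 (· ⊗ₖ ·) (Comb m H) (Comb n (fun i => H (2 * m + i))))} := by
  have iA : ∀ j : Fin (2 * m), Nonempty (H j) := fun j => hne _ (by omega)
  have iB : ∀ j : Fin (2 * n), Nonempty (H (2 * m + j)) := fun j => hne _ (by omega)
  rw [Kset_eq m n hm H hne, Kset_eq m n hm H hne, Comb_eq' m hm H (fun j hj => hne _ (by omega)),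
    Comb_eq' n hn (fun i => H (2 * m + i)) (fun j hj => hne _ (by omega)), ordS_refl]
  have hns := nrm_split H m n
  have hnw : nrm (fun j : Fin (2 * m + 2 * n) => H j) (ordS m n (sigmaSwap m n)) =
      nrm (fun j : Fin (2 * m + 2 * n) => H j) Fin.val := by
    unfold nrm; simp only [even_ordS]
  have hpA := nrm_pos (H := fun j : Fin (2 * m) => H j) Fin.val
  have hpB := nrm_pos (H := fun j : Fin (2 * n) => H (2 * m + j)) Fin.val
  have hmem : ∀ T : Matrix ((∀ j : Fin (2 * m), H j) × (∀ j : Fin (2 * n), H (2 * m + j)))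
      ((∀ j : Fin (2 * m), H j) × (∀ j : Fin (2 * n), H (2 * m + j))) ℂ,
      T ∈ (Set.image2 (· ⊗ₖ ·) (CombG (fun j : Fin (2 * m) => H j) Fin.val)
      (CombG (fun j : Fin (2 * n) => H (2 * m + j)) Fin.val)) → T.IsHermitian ∧
      T.trace = nrm (fun j : Fin (2 * m + 2 * n) => H j) Fin.val := by
    rintro _ ⟨M, hM, N, hN, rfl⟩
    refine ⟨?_, ?_⟩
    · simp only [Matrix.IsHermitian]
      rw [Matrix.conjTranspose_kronecker, hM.1.isHermitian, hN.1.isHermitian]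
    · simp only
      rw [Matrix.trace_kronecker, hM.2.2, hN.2.2, hns, Complex.ofReal_mul]
  ext R
  constructor
  · rintro ⟨⟨hR, hc1, ht⟩, ⟨_, hc2, _⟩⟩
    refine ⟨hR, ?_⟩
    refine affine_of_span _ (nrm (fun j : Fin (2 * m + 2 * n) => H j) Fin.val) ?_ hmem ?_ _ ?_ ?_ ?_
    · rw [hns]; positivity
    · exact ⟨_, _, CombG_scalar _, _, CombG_scalar _, rfl⟩
    · exact ((psd_reindex _ _).mpr hR).isHermitian
    · rw [trace_reindex', ht]
    · have hex := congrArg (Matrix.reindexLinearEquiv ℂ ℂ (splitPi (2 * m) (2 * n) H)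
        (splitPi (2 * m) (2 * n) H)) (expand R)
      rw [map_sum] at hex
      simp only [Matrix.coe_reindexLinearEquiv, map_smul] at hex
      rw [hex]
      refine Submodule.sum_mem _ fun γ _ => ?_
      by_cases h0 : ph R (fun i => fb (H i) (γ i)) = 0
      · rw [h0, mul_zero, zero_smul]; exact Submodule.zero_mem _
      refine Submodule.smul_mem _ _ ?_
      have g1 := hc1.good h0
      have g2 := hc2.good h0
      have gA : good (H := fun j : Fin (2 * m) => H j) Fin.val (fun j => γ (Fin.castAdd _ j)) := by
        intro j hj hi
        refine g2 (Fin.castAdd _ j) (by rw [even_ordS]; exact hj) fun i hlt => ?_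
        rw [ordS_swap_lt _ _ (Fin.castAdd _ j) j.isLt] at hlt
        by_cases hi2 : (i : ℕ) < 2 * m
        · rw [ordS_swap_lt _ _ i hi2] at hlt
          exact hi ⟨i, hi2⟩ (by simp at hlt; exact hlt)
        · rw [ordS_swap_ge _ _ i (by omega)] at hlt
          have := i.isLt
          omega
      have gB : good (H := fun j : Fin (2 * n) => H (2 * m + j)) Fin.val
          (fun j => γ (Fin.natAdd _ j)) := by
        intro j hj hi
        refine g1 (Fin.natAdd _ j) (by simpa [Nat.even_add] using hj) fun i hlt => ?_
        have hlt' : 2 * m + (j : ℕ) < i := hlt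
        obtain ⟨l, hl⟩ : ∃ l : Fin (2 * n), i = Fin.natAdd (2 * m) l :=
          ⟨⟨i - 2 * m, by omega⟩, Fin.ext (by simp only [Fin.val_natAdd]; omega)⟩
        subst hl
        exact hi l (by simpa using hlt')
      have sA := chain_span (good_chain gA)
      have sB := chain_span (good_chain gB)
      have := Submodule.apply_mem_map₂ (Matrix.kroneckerBilinear (R := ℂ)) sA sB
      rw [Submodule.map₂_span_span] at this
      rw [prodOp_transpose, reindex_splitPi_prodOp]
      exact this
  · rintro ⟨hR, hT⟩
    suffices h : (Chain Fin.val R ∧ Chain (ordS m n (sigmaSwap m n)) R) ∧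
        R.trace = nrm (fun j : Fin (2 * m + 2 * n) => H j) Fin.val from
      ⟨⟨hR, h.1.1, h.2⟩, ⟨hR, h.1.2, by rw [hnw]; exact h.2⟩⟩
    have key : ∀ T : Matrix ((∀ j : Fin (2 * m), H j) × (∀ j : Fin (2 * n), H (2 * m + j)))
      ((∀ j : Fin (2 * m), H j) × (∀ j : Fin (2 * n), H (2 * m + j))) ℂ,
      T ∈ affineSpan ℝ (Set.image2 (· ⊗ₖ ·) (CombG (fun j : Fin (2 * m) => H j) Fin.val)
      (CombG (fun j : Fin (2 * n) => H (2 * m + j)) Fin.val)) →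
      (Chain Fin.val (Matrix.reindex (splitPi (2 * m) (2 * n) H).symm (splitPi (2 * m) (2 * n) H).symm T)
        ∧ Chain (ordS m n (sigmaSwap m n))
          (Matrix.reindex (splitPi (2 * m) (2 * n) H).symm (splitPi (2 * m) (2 * n) H).symm T)) ∧
      T.trace = nrm (fun j : Fin (2 * m + 2 * n) => H j) Fin.val := by
      intro T hT
      refine affineSpan_induction (p := fun T => (Chain Fin.val (Matrix.reindex (splitPi (2 * m) (2 * n) H).symm (splitPi (2 * m) (2 * n) H).symm T)
        ∧ Chain (ordS m n (sigmaSwap m n))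
          (Matrix.reindex (splitPi (2 * m) (2 * n) H).symm (splitPi (2 * m) (2 * n) H).symm T)) ∧
        T.trace = nrm (fun j : Fin (2 * m + 2 * n) => H j) Fin.val) hT ?_ ?_
      · intro T hT
        refine ⟨?_, (hmem T hT).2⟩
        obtain ⟨M, hM, N, hN, rfl⟩ := hT
        constructor
        · intro X j a b c
          simp only
          rw [ph_kron]
          by_cases hj : (j : ℕ) < 2 * m
          · rw [hM.2.1 _ ⟨j, hj⟩ a b (fun i hi => c _ hi), zero_mul]
          · obtain ⟨l, hl⟩ : ∃ l : Fin (2 * n), j = Fin.natAdd (2 * m) l :=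
              ⟨⟨j - 2 * m, by omega⟩, Fin.ext (by simp only [Fin.val_natAdd]; omega)⟩
            subst hl
            rw [hN.2.1 _ l (by simpa [Nat.even_add] using a) b
              (fun i hi => c _ (by simpa using hi)), mul_zero]
        · intro X j a b c
          simp only
          rw [ph_kron]
          rw [even_ordS] at a
          by_cases hj : (j : ℕ) < 2 * m
          · rw [hM.2.1 _ ⟨j, hj⟩ a b (fun i hi => c (Fin.castAdd _ i) (by
              rw [ordS_swap_lt _ _ j hj, ordS_swap_lt _ _ _ (by exact i.isLt)]
              exact Nat.add_lt_add_left hi _)), zero_mul]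
          · obtain ⟨l, hl⟩ : ∃ l : Fin (2 * n), j = Fin.natAdd (2 * m) l :=
              ⟨⟨j - 2 * m, by omega⟩, Fin.ext (by simp only [Fin.val_natAdd]; omega)⟩
            subst hl
            rw [hN.2.1 _ l (by simpa [Nat.even_add] using a) b
              (fun i hi => c (Fin.natAdd _ i) (by
                rw [ordS_swap_ge _ _ _ (by simp), ordS_swap_ge _ _ _ (by simp)]
                simpa using hi)), mul_zero]
      · intro c u v w hu hv hw
        have e : Matrix.reindex (splitPi (2 * m) (2 * n) H).symm (splitPi (2 * m) (2 * n) H).symm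
          (c • (u -ᵥ v) +ᵥ w) = c • (Matrix.reindex (splitPi (2 * m) (2 * n) H).symm
            (splitPi (2 * m) (2 * n) H).symm u - Matrix.reindex (splitPi (2 * m) (2 * n) H).symm
            (splitPi (2 * m) (2 * n) H).symm v) + Matrix.reindex (splitPi (2 * m) (2 * n) H).symm
            (splitPi (2 * m) (2 * n) H).symm w := rfl
        rw [e]
        refine ⟨⟨((hu.1.1.sub hv.1.1).rsmul c).add hw.1.1, ((hu.1.2.sub hv.1.2).rsmul c).add hw.1.2⟩, ?_⟩
        rw [vsub_eq_sub, vadd_eq_add, Matrix.trace_add, Matrix.trace_smul, Matrix.trace_sub, hu.2, hv.2,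
          hw.2, sub_self, smul_zero, zero_add]
    have := key _ hT
    rw [← Matrix.reindex_symm, Equiv.symm_apply_apply, trace_reindex'] at this
    exact this

end Main

section Deg

def FE (p : ℕ) (G : ℕ → Type) : Prop :=
  ∀ j, j < 2 * p → ¬ Even j → IsEmpty (G j) → ∃ i, i < j ∧ IsEmpty (G i)

theorem FE_iff (p : ℕ) (G : ℕ → Type) (t : ℕ) (ht : IsEmpty (G t)) (hmin : ∀ i, i < t → ¬ IsEmpty (G i)) :
    FE p G ↔ (t < 2 * p → Even t) := by
  constructor
  · intro h hlt
    by_contra ho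
    obtain ⟨i, hi, he⟩ := h t hlt ho ht
    exact hmin i hi he
  · intro h j hj ho he
    have : t ≤ j := by by_contra hc; exact hmin j (by omega) he
    refine ⟨t, lt_of_le_of_ne this ?_, ht⟩
    rintro rfl
    exact ho (h hj)

theorem exists_min_empty (G : ℕ → Type) (h : ∃ j, IsEmpty (G j)) :
    ∃ t, IsEmpty (G t) ∧ ∀ i, i < t → ¬ IsEmpty (G i) := by
  classical
  exact ⟨Nat.find h, Nat.find_spec h, fun i hi => Nat.find_min h hi⟩

theorem pi_empty {q : ℕ} (G : ℕ → Type) {j : ℕ} (hj : j < q) (h : IsEmpty (G j)) :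
    IsEmpty (∀ i : Fin q, G i) := ⟨fun f => h.elim (f ⟨j, hj⟩)⟩

theorem forall_trace_zero {α : Type} [Fintype α] [DecidableEq α] :
    (∀ X : Matrix α α ℂ, 0 = X.trace) ↔ IsEmpty α := by
  constructor
  · intro h
    have := h 1
    rw [Matrix.trace_one] at this
    exact Fintype.card_eq_zero_iff.mp (by exact_mod_cast this.symm)
  · intro h X
    simp [Matrix.trace]

theorem pairE_empty (H : ℕ → Type) [∀ j, Fintype (H j)] [∀ j, DecidableEq (H j)] (k : ℕ)
    (R : Matrix (∀ j : Fin (k + 2), H j) (∀ j : Fin (k + 2), H j) ℂ)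
    (h : IsEmpty (∀ j : Fin (k + 2), H j)) (X S) : pairE H k R X S = 0 := by
  rw [Subsingleton.elim R 0]
  have : Matrix.reindex (splitEnds H k) (splitEnds H k)
    (0 : Matrix (∀ j : Fin (k + 2), H j) (∀ j : Fin (k + 2), H j) ℂ) = 0 := rfl
  rw [pairE, this, mul_zero, Matrix.trace_zero]

theorem Comb_nonempty : ∀ (n : ℕ) (H : ℕ → Type) [∀ j, Fintype (H j)] [∀ j, DecidableEq (H j)],
    (Comb (n + 1) H).Nonempty ↔ FE (n + 1) H := by
  intro n
  induction n with
  | zero =>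
    intro H _ _
    by_cases hne : ∀ j, j < 2 * (0 + 1) → Nonempty (H j)
    · have i1 : ∀ j : Fin (2 * (0 + 1)), Nonempty (H j) := fun j => hne _ j.isLt
      rw [Comb_eq 0 H hne]
      refine ⟨fun _ j hj _ he => absurd he (not_isEmpty_iff.mpr (hne j hj)), fun _ => ⟨_, CombG_scalar _⟩⟩
    · push Not at hne
      obtain ⟨j, hj, he⟩ := hne
      obtain ⟨t, ht, hmin⟩ := exists_min_empty H ⟨j, he⟩
      have htj : t ≤ j := by by_contra hc; exact hmin j (by omega) he
      have hE := pi_empty H hj he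
      rw [FE_iff _ H t ht hmin]
      have : (Comb (0 + 1) H).Nonempty ↔ IsEmpty (H 0) := by
        rw [← forall_trace_zero]
        constructor
        · rintro ⟨R, hR⟩ X
          rw [← ((Comb_one_iff H R).mp hR).2 X, pairE_empty H 0 R hE]
        · intro h
          refine ⟨0, (Comb_one_iff H 0).mpr ⟨Matrix.PosSemidef.zero, fun X => ?_⟩⟩
          rw [pairE_empty H 0 0 hE]; exact h X
      rw [this]
      constructor
      · intro h0 _
        have : t = 0 := by by_contra hc; exact hmin 0 (by omega) h0
        rw [this]; simp
      · intro h
        have h2 := h (by omega)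
        have : t = 0 := by rw [Nat.even_iff] at h2; omega
        rw [← this]; exact ht
  | succ n ih =>
    intro H _ _
    by_cases hne : ∀ j, j < 2 * (n + 1 + 1) → Nonempty (H j)
    · have i1 : ∀ j : Fin (2 * (n + 1 + 1)), Nonempty (H j) := fun j => hne _ j.isLt
      rw [Comb_eq (n + 1) H hne]
      refine ⟨fun _ j hj _ he => absurd he (not_isEmpty_iff.mpr (hne j hj)), fun _ => ⟨_, CombG_scalar _⟩⟩
    · push Not at hne
      obtain ⟨j, hj, he⟩ := hne
      obtain ⟨t, ht, hmin⟩ := exists_min_empty H ⟨j, he⟩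
      have htj : t ≤ j := by by_contra hc; exact hmin j (by omega) he
      have hE := pi_empty H hj he
      rw [FE_iff _ H t ht hmin]
      have : (Comb (n + 1 + 1) H).Nonempty ↔
          (FE (n + 1) (fun j => H (j + 1)) → IsEmpty (H 0)) := by
        rw [← ih, ← forall_trace_zero]
        constructor
        · rintro ⟨R, hR⟩ ⟨S, hS⟩ X
          rw [← ((Comb_succ_iff H n R).mp hR).2 S hS X, pairE_empty H (2 * (n + 1)) R hE]
        · intro h
          refine ⟨0, (Comb_succ_iff H n 0).mpr ⟨Matrix.PosSemidef.zero, fun S hS X => ?_⟩⟩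
          rw [pairE_empty H (2 * (n + 1)) 0 hE]; exact h ⟨S, hS⟩ X
      rw [this]
      rcases Nat.eq_zero_or_pos t with h0 | h0
      · subst h0
        simp [ht]
      · have h1 : ¬ IsEmpty (H 0) := hmin 0 h0
        obtain ⟨s, rfl⟩ : ∃ s, t = s + 1 := ⟨t - 1, by omega⟩
        rw [FE_iff (n + 1) (fun j => H (j + 1)) s ht (fun i hi => hmin _ (by omega))]
        simp only [h1, imp_false, Nat.even_iff]
        omega

theorem ext_refl (p i : ℕ) : extendPerm (toothReorder (Equiv.refl (Fin p))) i = i := by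
  rw [extendPerm]
  split_ifs with h
  · rw [toothReorder_val]
    simp only [Equiv.refl_symm, Equiv.refl_apply]
    omega
  · rfl

theorem ext_swap_lt (m n i : ℕ) (hi : i < 2 * n) :
    extendPerm (toothReorder (sigmaSwap m n)) i = 2 * m + i := by
  rw [extendPerm, dif_pos (by omega), toothReorder_val]
  simp only [sigmaSwap, Equiv.coe_fn_symm_mk]
  rw [if_pos (by omega)]
  omega

theorem ext_swap_ge (m n i : ℕ) (hi : 2 * n ≤ i) (hi2 : i < 2 * (m + n)) :
    extendPerm (toothReorder (sigmaSwap m n)) i = i - 2 * n := by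
  rw [extendPerm, dif_pos (by omega), toothReorder_val]
  simp only [sigmaSwap, Equiv.coe_fn_symm_mk]
  rw [if_neg (by omega)]
  omega

theorem Comb_nonempty' (p : ℕ) (hp : 1 ≤ p) (H : ℕ → Type) [∀ j, Fintype (H j)]
    [∀ j, DecidableEq (H j)] : (Comb p H).Nonempty ↔ FE p H := by
  obtain ⟨q, rfl⟩ : ∃ q, p = q + 1 := ⟨p - 1, by omega⟩
  exact Comb_nonempty q H

theorem mem_iff_nonempty {α : Type} [Subsingleton α] (s : Set α) (x : α) : x ∈ s ↔ s.Nonempty :=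
  ⟨fun h => ⟨x, h⟩, fun ⟨y, hy⟩ => by rwa [Subsingleton.elim x y]⟩

theorem main_deg (H : ℕ → Type) [∀ j, Fintype (H j)] [∀ j, DecidableEq (H j)]
    (m n : ℕ) (hm : 1 ≤ m) (hn : 1 ≤ n) (j : ℕ) (hj : j < 2 * m + 2 * n) (he : IsEmpty (H j)) :
    Kset m n H (Equiv.refl (Fin (m + n))) ∩ Kset m n H (sigmaSwap m n) =
      {R : Matrix (∀ j : Fin (2 * m + 2 * n), H j) (∀ j : Fin (2 * m + 2 * n), H j) ℂ |
        R.PosSemidef ∧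
        Matrix.reindex (splitPi (2 * m) (2 * n) H) (splitPi (2 * m) (2 * n) H) R ∈
          affineSpan ℝ (Set.image2 (· ⊗ₖ ·) (Comb m H) (Comb n (fun i => H (2 * m + i))))} := by
  have hE := pi_empty H hj he
  have hK : ∀ σ R, R ∈ Kset m n H σ ↔ FE (m + n) (fun i => H (extendPerm (toothReorder σ) i)) := by
    intro σ R
    have hE2 : IsEmpty (∀ j : Fin (2 * (m + n)), H (extendPerm (toothReorder σ) j)) :=
      ((piFinCast H (by omega : 2 * m + 2 * n = 2 * (m + n))).trans
          (permEquiv H (toothReorder σ))).symm.isEmpty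
    rw [Kset, Set.mem_ofPred_eq, mem_iff_nonempty, Comb_nonempty' (m + n) (by omega),
      Subsingleton.elim R 0]
    exact and_iff_right Matrix.PosSemidef.zero
  ext R
  have hE3 : IsEmpty ((∀ j : Fin (2 * m), H j) × (∀ j : Fin (2 * n), H (2 * m + j))) :=
    (splitPi (2 * m) (2 * n) H).symm.isEmpty
  rw [Set.mem_inter_iff, hK, hK, Set.mem_ofPred_eq, ← SetLike.mem_coe, mem_iff_nonempty,
    affineSpan_nonempty, Set.image2_nonempty_iff, Comb_nonempty' m hm, Comb_nonempty' n hn,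
    Subsingleton.elim R 0, and_iff_right Matrix.PosSemidef.zero]
  simp only [ext_refl]
  constructor
  · rintro ⟨h1, h2⟩
    refine ⟨fun j hj ho he => h1 j (by omega) ho he, fun j hj ho he => ?_⟩
    obtain ⟨i, hi, hie⟩ := h2 j (by omega) ho (by beta_reduce; rw [ext_swap_lt m n j hj]; exact he)
    refine ⟨i, hi, ?_⟩
    beta_reduce at hie
    rw [ext_swap_lt m n i (by omega)] at hie
    exact hie
  · rintro ⟨h1, h2⟩
    constructor
    · intro j hj ho he
      by_cases hjm : j < 2 * m
      · exact h1 j hjm ho he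
      · obtain ⟨l, rfl⟩ : ∃ l, j = 2 * m + l := ⟨j - 2 * m, by omega⟩
        obtain ⟨i, hi, hie⟩ := h2 l (by omega) (by simpa [Nat.even_add] using ho) he
        exact ⟨2 * m + i, by omega, hie⟩
    · intro j hj ho he
      by_cases hjn : j < 2 * n
      · beta_reduce at he
        rw [ext_swap_lt m n j hjn] at he
        obtain ⟨i, hi, hie⟩ := h2 j hjn ho he
        exact ⟨i, hi, by beta_reduce; rw [ext_swap_lt m n i (by omega)]; exact hie⟩
      · beta_reduce at he
        rw [ext_swap_ge m n j (by omega) hj] at he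
        obtain ⟨l, rfl⟩ : ∃ l, j = 2 * n + l := ⟨j - 2 * n, by omega⟩
        rw [Nat.add_sub_cancel_left] at he
        obtain ⟨i, hi, hie⟩ := h1 l (by omega) (by simpa [Nat.even_add] using ho) he
        refine ⟨2 * n + i, by omega, ?_⟩
        beta_reduce
        rw [ext_swap_ge m n _ (by omega) (by omega), Nat.add_sub_cancel_left]
        exact hie

end Deg


/-- with `σ↔` the block-exchange shuffle (`σ↔(i) = n+i` for `i < m`,
`σ↔(m+j) = j`), `K_id ∩ K_{σ↔}` equals the set of PSD operators on
`H = A_0⊗⋯⊗A_{2m−1}⊗B_0⊗⋯⊗B_{2n−1}` lying in the affine span (over ℝ) of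
`{M⊗N : M ∈ Comb_m(A…), N ∈ Comb_n(B…)}`. -/
theorem stmt_2 (m n : ℕ) (hm : 1 ≤ m) (hn : 1 ≤ n) (H : ℕ → Type)
    [∀ j, Fintype (H j)] [∀ j, DecidableEq (H j)] :
    Kset m n H (Equiv.refl (Fin (m + n))) ∩ Kset m n H (sigmaSwap m n) =
      {R : Matrix (∀ j : Fin (2 * m + 2 * n), H j) (∀ j : Fin (2 * m + 2 * n), H j) ℂ |
        R.PosSemidef ∧
        Matrix.reindex (splitPi (2 * m) (2 * n) H) (splitPi (2 * m) (2 * n) H) R ∈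
          affineSpan ℝ (Set.image2 (· ⊗ₖ ·) (Comb m H) (Comb n (fun i => H (2 * m + i))))} := by
  by_cases hne : ∀ j, j < 2 * m + 2 * n → Nonempty (H j)
  · exact main_nondeg H m n hm hn hne
  · push Not at hne
    obtain ⟨j, hj, he⟩ := hne
    exact main_deg H m n hm hn j hj he

end
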